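/- arXiv:2302.11295 — 7 statements merged into one kernel-verified Lean document; each statement's English description precedes it below -/
import Mathlib

section
/- Let F be a forest whose vertices are colored with k ≥ 2 colors in ratio c_1:c_2:…:c_k, where the c_i are positive integers with gcd(c_1,…,c_k)=1 and d = c_1+…+c_k ≥ 3. Then every fair partition of the vertices of F of minimum correlation clustering cost among all fair partitions has all parts of size exactly d. -/
open Finset

/-- Two vertices lie in a common block of the clustering `P`. -/
def SameBlock {V : Type*} (P : Finset (Finset V)) (u v : V) : Prop :=
  ∃ S ∈ P, u ∈ S ∧ v ∈ S

/-- Inter-cluster cost: the number of edges whose endpoints lie in different blocks of `P`. -/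
noncomputable def interCost {V : Type*} (G : SimpleGraph V) (P : Finset (Finset V)) : ℕ :=
  {e : Sym2 V | e ∈ G.edgeSet ∧ ∃ u ∈ e, ∃ v ∈ e, ¬ SameBlock P u v}.ncard

/-- Intra-cluster cost: the number of non-adjacent pairs of distinct vertices lying in a
common block of `P`. -/
noncomputable def intraCost {V : Type*} (G : SimpleGraph V) (P : Finset (Finset V)) : ℕ :=
  {e : Sym2 V | ¬ e.IsDiag ∧ e ∉ G.edgeSet ∧ ∀ u ∈ e, ∀ v ∈ e, SameBlock P u v}.ncard

/-- The correlation clustering cost of a clustering `P` on the graph `G`. -/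
noncomputable def ccCost {V : Type*} (G : SimpleGraph V) (P : Finset (Finset V)) : ℕ :=
  intraCost G P + interCost G P

/-- A set `S` is fair w.r.t. the coloring `col`: for each color, the fraction of `S`
of that color equals the global fraction (stated by cross multiplication). -/
def FairSet {V : Type*} [Fintype V] {k : ℕ} (col : V → Fin k) (S : Finset V) : Prop :=
  ∀ i : Fin k,
    (S.filter fun v => col v = i).card * Fintype.card V
      = (Finset.univ.filter fun v => col v = i).card * S.card

section Forest

variable {V : Type*}

open Classical in
/-- The edges of `F` with both endpoints in `T`. -/
noncomputable def edgesWithin [Fintype V] [DecidableEq V]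
    (F : SimpleGraph V) (T : Finset V) : Finset (Sym2 V) :=
  F.edgeFinset ∩ T.sym2

theorem mk_mem_edgesWithin [Fintype V] [DecidableEq V]
    {F : SimpleGraph V} {T : Finset V} {u v : V} :
    s(u, v) ∈ edgesWithin F T ↔ F.Adj u v ∧ u ∈ T ∧ v ∈ T := by
  simp [edgesWithin]

theorem SimpleGraph.IsAcyclic.card_edgeFinset_lt {W : Type*} [Fintype W] [Nonempty W]
    {G : SimpleGraph W}
    [Fintype G.edgeSet] (hG : G.IsAcyclic) : G.edgeFinset.card < Fintype.card W := by
  classical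
  obtain ⟨T, hGT, -, hT⟩ :=
    SimpleGraph.connected_top.exists_isTree_le_of_le_of_isAcyclic (le_top : G ≤ ⊤) hG
  have h := hT.card_edgeFinset
  have h' := Finset.card_le_card (SimpleGraph.edgeFinset_mono hGT)
  omega

theorem card_edgesWithin_lt [Fintype V] [DecidableEq V]
    {F : SimpleGraph V} (hF : F.IsAcyclic) {T : Finset V}
    (hT : T.Nonempty) : (edgesWithin F T).card < T.card := by
  classical
  have : Nonempty (T : Set V) := hT.to_subtype
  have h := (hF.induce (T : Set V)).card_edgeFinset_lt
  have h' := F.card_filter_edgeFinset_toFinset_subset T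
  rw [SimpleGraph.filter_edgeFinset_toFinset_subset] at h'
  unfold edgesWithin
  rw [h']
  simpa using h

/-- The unordered pairs with one element in `S` and the other one in `T`. -/
def crossPairs [DecidableEq V] (S T : Finset V) : Finset (Sym2 V) :=
  (S ×ˢ T).image fun p => s(p.1, p.2)

theorem mk_mem_crossPairs [DecidableEq V] {S T : Finset V} {u v : V} :
    s(u, v) ∈ crossPairs S T ↔ (u ∈ S ∧ v ∈ T) ∨ (v ∈ S ∧ u ∈ T) := by
  simp only [crossPairs, mem_image, mem_product, Prod.exists, Sym2.eq_iff]
  constructor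
  · rintro ⟨a, b, ⟨ha, hb⟩, ⟨rfl, rfl⟩ | ⟨rfl, rfl⟩⟩ <;> simp [ha, hb]
  · rintro (h | h)
    · exact ⟨u, v, h, by simp⟩
    · exact ⟨v, u, h, by simp⟩

theorem card_crossPairs [DecidableEq V] {S T : Finset V} (h : Disjoint S T) :
    (crossPairs S T).card = S.card * T.card := by
  rw [crossPairs, card_image_of_injOn, card_product]
  rintro ⟨a, b⟩ hab ⟨c, d⟩ hcd heq
  simp only [coe_product, Set.mem_prod, mem_coe] at hab hcd
  rcases Sym2.eq_iff.1 heq with ⟨h1, h2⟩ | ⟨h1, h2⟩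
  · exact Prod.ext h1 h2
  · exact absurd (show a ∈ T from (show a = d from h1) ▸ hcd.2) (disjoint_left.1 h hab.1)

open Classical in
/-- The edges of `F` with one endpoint in `S` and the other one in `T`. -/
noncomputable def crossEdges [DecidableEq V]
    (F : SimpleGraph V) (S T : Finset V) : Finset (Sym2 V) :=
  (crossPairs S T).filter (· ∈ F.edgeSet)

theorem mk_mem_crossEdges [DecidableEq V] {F : SimpleGraph V} {S T : Finset V} {u v : V} :
    s(u, v) ∈ crossEdges F S T ↔ ((u ∈ S ∧ v ∈ T) ∨ (v ∈ S ∧ u ∈ T)) ∧ F.Adj u v := by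
  simp [crossEdges, mk_mem_crossPairs]

theorem crossEdges_sdiff_subset [Fintype V] [DecidableEq V]
    {F : SimpleGraph V} {S A : Finset V} (hA : A ⊆ S) :
    crossEdges F A (S \ A) ⊆ edgesWithin F S := by
  intro e
  induction e using Sym2.ind with | h u v
  rw [mk_mem_crossEdges, mk_mem_edgesWithin]
  grind

theorem SameBlock.symm {P : Finset (Finset V)} {u v : V} (h : SameBlock P u v) :
    SameBlock P v u := by
  obtain ⟨S, hS, hu, hv⟩ := h
  exact ⟨S, hS, hv, hu⟩

theorem Finpartition.sameBlock_self [Fintype V] [DecidableEq V]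
    (P : Finpartition (univ : Finset V)) (u : V) :
    SameBlock P.parts u u := by
  obtain ⟨S, hS, hu⟩ := P.exists_mem (mem_univ u)
  exact ⟨S, hS, hu, hu⟩

/-- Characterization of the pairs counted by `intraCost`. -/
theorem mk_mem_intra [Fintype V] [DecidableEq V]
    {F : SimpleGraph V} (P : Finpartition (univ : Finset V)) {u v : V} :
    s(u, v) ∈ {e : Sym2 V | ¬ e.IsDiag ∧ e ∉ F.edgeSet ∧
        ∀ u ∈ e, ∀ v ∈ e, SameBlock P.parts u v} ↔
      u ≠ v ∧ ¬ F.Adj u v ∧ SameBlock P.parts u v := by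
  have hu := Finpartition.sameBlock_self P u
  have hv := Finpartition.sameBlock_self P v
  have hs : SameBlock P.parts u v ↔ SameBlock P.parts v u := ⟨.symm, .symm⟩
  simp only [Set.mem_ofPred_eq, Sym2.mk_isDiag_iff, SimpleGraph.mem_edgeSet, Sym2.mem_iff,
    forall_eq_or_imp, forall_eq, ne_eq]
  tauto

/-- Characterization of the edges counted by `interCost`. -/
theorem mk_mem_inter [Fintype V] [DecidableEq V]
    {F : SimpleGraph V} (P : Finpartition (univ : Finset V)) {u v : V} :
    s(u, v) ∈ {e : Sym2 V | e ∈ F.edgeSet ∧ ∃ u ∈ e, ∃ v ∈ e, ¬ SameBlock P.parts u v} ↔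
      F.Adj u v ∧ ¬ SameBlock P.parts u v := by
  have hu := Finpartition.sameBlock_self P u
  have hv := Finpartition.sameBlock_self P v
  have hs : SameBlock P.parts u v ↔ SameBlock P.parts v u := ⟨.symm, .symm⟩
  simp only [Set.mem_ofPred_eq, SimpleGraph.mem_edgeSet, Sym2.mem_iff, exists_eq_or_imp,
    exists_eq_left]
  tauto

/-- The partition obtained from `P` by splitting the part `S` into `A` and `S \ A`. -/
def splitPart [Fintype V] [DecidableEq V]
    (P : Finpartition (univ : Finset V)) {S A : Finset V} (hS : S ∈ P.parts)
    (hA : A ⊆ S) (hne : A.Nonempty) (hne' : (S \ A).Nonempty) :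
    Finpartition (univ : Finset V) :=
  .ofExistsUnique (insert A (insert (S \ A) (P.parts.erase S))) (fun _ _ => subset_univ _)
    (by
      intro x _
      by_cases hx : x ∈ S
      · have huniq : ∀ T ∈ P.parts, x ∈ T → T = S := fun T hT hxT => P.eq_of_mem_parts hT hS hxT hx
        by_cases hxA : x ∈ A
        · exact ⟨A, by simp [hxA], by grind⟩
        · exact ⟨S \ A, by simp [hx, hxA], by grind⟩
      · obtain ⟨T, ⟨hT, hxT⟩, huniq⟩ := P.existsUnique_mem (mem_univ x)
        exact ⟨T, by grind, by grind⟩)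
    (by
      have := P.empty_notMem_parts
      have := hne.ne_empty
      have := hne'.ne_empty
      grind)

theorem sameBlock_splitPart [Fintype V] [DecidableEq V]
    (P : Finpartition (univ : Finset V)) {S A : Finset V}
    (hS : S ∈ P.parts) (hA : A ⊆ S) (hne : A.Nonempty) (hne' : (S \ A).Nonempty) {u v : V} :
    SameBlock P.parts u v ↔ SameBlock (splitPart P hS hA hne hne').parts u v ∨
      s(u, v) ∈ crossPairs A (S \ A) := by
  rw [mk_mem_crossPairs]
  change _ ↔ SameBlock (insert A (insert (S \ A) (P.parts.erase S))) u v ∨ _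
  unfold SameBlock
  simp only [mem_insert, exists_eq_or_imp, mem_erase]
  constructor
  · rintro ⟨T, hT, hu, hv⟩
    by_cases h : T = S
    · subst h
      simp only [mem_sdiff, hu, hv]
      tauto
    · exact .inl (.inr (.inr ⟨T, ⟨h, hT⟩, hu, hv⟩))
  · have := hA
    rintro ((h | h | ⟨T, h, h'⟩) | h)
    · exact ⟨S, hS, hA h.1, hA h.2⟩
    · exact ⟨S, hS, by grind, by grind⟩
    · exact ⟨T, h.2, h'⟩
    · exact ⟨S, hS, by grind, by grind⟩

theorem not_sameBlock_splitPart [Fintype V] [DecidableEq V]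
    (P : Finpartition (univ : Finset V)) {S A : Finset V}
    (hS : S ∈ P.parts) (hA : A ⊆ S) (hne : A.Nonempty) (hne' : (S \ A).Nonempty) {u v : V}
    (h : s(u, v) ∈ crossPairs A (S \ A)) :
    ¬ SameBlock (splitPart P hS hA hne hne').parts u v := by
  rw [mk_mem_crossPairs] at h
  change ¬ SameBlock (insert A (insert (S \ A) (P.parts.erase S))) u v
  rintro ⟨T, hT, hu, hv⟩
  simp only [mem_insert, mem_erase] at hT
  rcases hT with rfl | rfl | ⟨hTS, hT⟩
  · grind
  · grind
  · have huS : u ∈ S := by grind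
    exact hTS (P.eq_of_mem_parts hT hS hu huS)

/-- Splitting a part saves the non-adjacent pairs across the split and pays the edges across. -/
theorem ccCost_splitPart [Fintype V] [DecidableEq V]
    (F : SimpleGraph V) (P : Finpartition (univ : Finset V))
    {S A : Finset V} (hS : S ∈ P.parts) (hA : A ⊆ S) (hne : A.Nonempty)
    (hne' : (S \ A).Nonempty) :
    ccCost F (splitPart P hS hA hne hne').parts + A.card * (S \ A).card =
      ccCost F P.parts + 2 * (crossEdges F A (S \ A)).card := by
  classical
  set Q := splitPart P hS hA hne hne'
  have hsame : ∀ u v, SameBlock P.parts u v ↔ SameBlock Q.parts u v ∨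
      s(u, v) ∈ crossPairs A (S \ A) := fun u v => sameBlock_splitPart P hS hA hne hne'
  have hcross : ∀ u v, s(u, v) ∈ crossPairs A (S \ A) → ¬ SameBlock Q.parts u v :=
    fun u v => not_sameBlock_splitPart P hS hA hne hne'
  have hdiag : ∀ u v, s(u, v) ∈ crossPairs A (S \ A) → u ≠ v := by
    intro u v
    rw [mk_mem_crossPairs]
    grind
  have hintra : intraCost F P.parts =
      intraCost F Q.parts + ((crossPairs A (S \ A)).filter (· ∉ F.edgeSet)).card := by
    unfold intraCost
    rw [← Set.ncard_coe_finset, ← Set.ncard_union_eq]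
    · congr 1
      ext e
      induction e using Sym2.ind with | h u v
      rw [Set.mem_union, mk_mem_intra, mk_mem_intra, mem_coe, mem_filter,
        SimpleGraph.mem_edgeSet, hsame]
      have := hdiag u v
      tauto
    · rw [Set.disjoint_left]
      intro e
      induction e using Sym2.ind with | h u v
      rw [mk_mem_intra, mem_coe, mem_filter]
      have := hcross u v
      tauto
  have hinter : interCost F Q.parts =
      interCost F P.parts + (crossEdges F A (S \ A)).card := by
    unfold interCost
    rw [← Set.ncard_coe_finset, ← Set.ncard_union_eq]
    · congr 1
      ext e
      induction e using Sym2.ind with | h u v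
      rw [Set.mem_union, mk_mem_inter, mk_mem_inter, mem_coe, crossEdges, mem_filter,
        SimpleGraph.mem_edgeSet, hsame]
      have := hcross u v
      tauto
    · rw [Set.disjoint_left]
      intro e
      induction e using Sym2.ind with | h u v
      rw [mk_mem_inter, mem_coe, crossEdges, mem_filter, hsame]
      tauto
  have hcard : A.card * (S \ A).card = (crossEdges F A (S \ A)).card +
      ((crossPairs A (S \ A)).filter (· ∉ F.edgeSet)).card := by
    rw [← card_crossPairs disjoint_sdiff, crossEdges, card_filter_add_card_filter_not]
  unfold ccCost
  omega

/-- If two splits of `S` that differ by exchanging `a` and `b` both separate every edge inside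
`S`, then every such edge is `s(a, b)` or avoids both `a` and `b`. -/
theorem card_le_of_crossEdges_exchange [Fintype V] [DecidableEq V]
    {F : SimpleGraph V} {S A : Finset V} {a b : V}
    (ha : a ∈ A) (hb : b ∈ S \ A)
    (h₁ : edgesWithin F S ⊆ crossEdges F A (S \ A))
    (h₂ : edgesWithin F S ⊆ crossEdges F (insert b (A.erase a)) (S \ insert b (A.erase a))) :
    (edgesWithin F S).card ≤ (edgesWithin F ((S.erase a).erase b)).card + 1 := by
  refine (card_le_card (t := insert s(a, b) (edgesWithin F ((S.erase a).erase b))) ?_).trans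
    (card_insert_le _ _)
  intro e he
  have h1 := h₁ he
  have h2 := h₂ he
  induction e using Sym2.ind with | h u v
  rw [mk_mem_crossEdges] at h1 h2
  rw [mk_mem_edgesWithin] at he
  rw [mem_insert, mk_mem_edgesWithin, Sym2.eq_iff]
  grind

end Forest

section Fair

variable {V : Type*} {k : ℕ} {col : V → Fin k} {cs : Fin k → ℕ}

theorem fairSet_iff [Fintype V] [Nonempty V] (hd : 0 < ∑ j, cs j)
    (hratio : ∀ i : Fin k, (univ.filter fun v => col v = i).card * (∑ j, cs j)
      = cs i * Fintype.card V) {S : Finset V} :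
    FairSet col S ↔
      ∀ i, (S.filter fun v => col v = i).card * (∑ j, cs j) = cs i * S.card := by
  have hV : 0 < Fintype.card V := Fintype.card_pos
  refine forall_congr' fun i => ?_
  have h := hratio i
  constructor <;> intro h'
  · refine Nat.eq_of_mul_eq_mul_right hV ?_
    linear_combination (∑ j, cs j) * h' + S.card * h
  · refine Nat.eq_of_mul_eq_mul_right hd ?_
    linear_combination Fintype.card V * h' - S.card * h

theorem card_eq_sum_card_filter (S : Finset V) :
    S.card = ∑ i, (S.filter fun v => col v = i).card :=
  card_eq_sum_card_fiberwise fun _ _ => mem_coe.2 (mem_univ _)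

theorem dvd_card_of_ratio (hgcd : univ.gcd cs = 1) {S : Finset V}
    (hS : ∀ i, (S.filter fun v => col v = i).card * (∑ j, cs j) = cs i * S.card) :
    (∑ j, cs j) ∣ S.card := by
  have h : (∑ j, cs j) ∣ univ.gcd fun i => cs i * S.card :=
    dvd_gcd fun i _ => ⟨_, by rw [← hS i, mul_comm]⟩
  rw [Finset.gcd_mul_right, hgcd] at h
  simpa using h

theorem exists_subset_card_filter_eq [DecidableEq V] {S : Finset V}
    (h : ∀ i, cs i ≤ (S.filter fun v => col v = i).card) :
    ∃ A ⊆ S, ∀ i, (A.filter fun v => col v = i).card = cs i := by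
  choose t ht hc using fun i => exists_subset_card_eq (h i)
  have hmem : ∀ i, ∀ v ∈ t i, v ∈ S ∧ col v = i := fun i v hv => mem_filter.1 (ht i hv)
  refine ⟨univ.biUnion t, biUnion_subset.2 fun i _ v hv => (hmem i v hv).1, fun i => ?_⟩
  rw [← hc i]
  congr 1
  ext v
  simp only [mem_filter, mem_biUnion, mem_univ, true_and]
  constructor
  · rintro ⟨⟨j, hj⟩, rfl⟩
    rwa [(hmem j v hj).2]
  · exact fun hv => ⟨⟨i, hv⟩, (hmem i v hv).2⟩

theorem card_filter_exchange [DecidableEq V] {A : Finset V} {a b : V} (ha : a ∈ A) (hb : b ∉ A)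
    (hab : col a = col b) (i : Fin k) :
    ((insert b (A.erase a)).filter fun v => col v = i).card =
      (A.filter fun v => col v = i).card := by
  rw [filter_insert, filter_erase]
  split_ifs with h
  · have ha' : a ∈ A.filter fun v => col v = i := mem_filter.2 ⟨ha, hab.trans h⟩
    rw [card_insert_of_notMem (by simp [hb]), card_erase_add_one ha']
  · rw [erase_eq_of_notMem (by simp [hab, h])]

end Fair

/-- In a forest colored with `k ≥ 2` colors in ratio `c₁ : … : c_k`
(coprime positive integers with sum `d ≥ 3`), every fair partition of minimum
correlation clustering cost among all fair partitions has all parts of size exactly `d`. -/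
theorem stmt1 {V : Type*} [Fintype V] [DecidableEq V]
    (F : SimpleGraph V) (hF : F.IsAcyclic)
    (k : ℕ) (hk : 2 ≤ k) (col : V → Fin k) (cs : Fin k → ℕ)
    (hpos : ∀ i, 0 < cs i) (hgcd : Finset.univ.gcd cs = 1)
    (hratio : ∀ i : Fin k,
      (Finset.univ.filter fun v => col v = i).card * (∑ j, cs j)
        = cs i * Fintype.card V)
    (hd : 3 ≤ ∑ j, cs j)
    (P : Finpartition (Finset.univ : Finset V))
    (hfair : ∀ S ∈ P.parts, FairSet col S)
    (hopt : ∀ Q : Finpartition (Finset.univ : Finset V),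
      (∀ S ∈ Q.parts, FairSet col S) → ccCost F P.parts ≤ ccCost F Q.parts) :
    ∀ S ∈ P.parts, S.card = ∑ j, cs j := by
  intro S hS
  set d := ∑ j, cs j with hd_def
  have hSne := P.nonempty_of_mem_parts hS
  have : Nonempty V := ⟨hSne.choose⟩
  have hd0 : 0 < d := by omega
  have hfairS := (fairSet_iff hd0 hratio).1 (hfair S hS)
  obtain ⟨m, hm⟩ := dvd_card_of_ratio hgcd hfairS
  rw [← hd_def] at hm
  have hcol : ∀ i, (S.filter fun v => col v = i).card = cs i * m := fun i => by
    refine Nat.eq_of_mul_eq_mul_right hd0 ?_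
    rw [hfairS i, hm]
    ring
  have hSpos := hSne.card_pos
  have hm0 : 0 < m := Nat.pos_of_mul_pos_left (hm ▸ hSpos)
  by_contra hcard
  have hm2 : 2 ≤ m := by
    by_contra h
    obtain rfl : m = 1 := by omega
    exact hcard (by omega)
  have hSd : (m - 1) * d + d = S.card := by
    rw [hm, ← Nat.succ_mul, Nat.succ_eq_add_one, Nat.sub_add_cancel hm0, mul_comm]
  have hsplit : ∀ A ⊆ S, (∀ i, (A.filter fun v => col v = i).card = cs i) →
      d * ((m - 1) * d) ≤ 2 * (crossEdges F A (S \ A)).card := by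
    intro A hAS hA
    have hAcard : A.card = d := by
      rw [card_eq_sum_card_filter (col := col) A, hd_def]
      exact sum_congr rfl fun i _ => hA i
    have hBcard : (S \ A).card = (m - 1) * d := by
      rw [card_sdiff_of_subset hAS]
      omega
    have hAne : A.Nonempty := card_pos.1 (by omega)
    have hBne : (S \ A).Nonempty := card_pos.1 (by rw [hBcard]; exact Nat.mul_pos (by omega) hd0)
    have hfairA : FairSet col A := (fairSet_iff hd0 hratio).2 fun i => by rw [hA, hAcard]
    have hfairB : FairSet col (S \ A) := fun i => by
      have h1 := hfairA i
      have h2 := hfair S hS i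
      have h3 : ((S \ A).filter fun v => col v = i).card + (A.filter fun v => col v = i).card =
          (S.filter fun v => col v = i).card := by
        rw [← card_union_of_disjoint (disjoint_filter_filter sdiff_disjoint), ← filter_union,
          sdiff_union_of_subset hAS]
      have h4 := card_sdiff_add_card_eq_card hAS
      rw [← h3, ← h4] at h2
      linarith
    have hle := hopt (splitPart P hS hAS hAne hBne) fun T hT => by
      change T ∈ insert A (insert (S \ A) (P.parts.erase S)) at hT
      simp only [mem_insert, mem_erase] at hT
      rcases hT with rfl | rfl | ⟨-, hT⟩
      exacts [hfairA, hfairB, hfair T hT]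
    have h := ccCost_splitPart F P hS hAS hAne hBne
    rw [hAcard, hBcard] at h
    omega
  obtain ⟨A, hAS, hA⟩ := exists_subset_card_filter_eq (col := col) (cs := cs) (S := S) fun i => by
    rw [hcol]
    exact Nat.le_mul_of_pos_right _ hm0
  have hedges := card_edgesWithin_lt hF hSne
  have hA1 := hsplit A hAS hA
  have hA2 := card_le_card (crossEdges_sdiff_subset (F := F) hAS)
  have hsmall : d = 3 ∧ m = 2 := by
    obtain ⟨n, rfl⟩ : ∃ n, m = n + 2 := ⟨m - 2, by omega⟩
    have h : d * ((n + 1) * d) + 2 ≤ 2 * (d * (n + 2)) := by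
      have : n + 2 - 1 = n + 1 := rfl
      rw [this] at hA1
      omega
    constructor
    · by_contra hne
      have : 4 ≤ d := by omega
      nlinarith [Nat.mul_le_mul_right ((n + 1) * d) this]
    · by_contra hne
      nlinarith [Nat.mul_le_mul_right ((n + 1) * d) hd, show 1 ≤ n by omega]
  obtain ⟨hd3, rfl⟩ := hsmall
  rw [hd3] at hA1 hSd hsplit
  let i : Fin k := ⟨0, by omega⟩
  have hi := hpos i
  obtain ⟨a, ha⟩ : (A.filter fun v => col v = i).Nonempty := card_pos.1 (by rw [hA]; exact hi)
  obtain ⟨b, hb⟩ : ((S.filter fun v => col v = i) \ (A.filter fun v => col v = i)).Nonempty :=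
    card_pos.1 (by
      rw [card_sdiff_of_subset (filter_subset_filter _ hAS), hA, hcol]
      omega)
  simp only [mem_filter, mem_sdiff] at ha hb
  have hbA : b ∉ A := fun h => hb.2 ⟨h, hb.1.2⟩
  have hBS : insert b (A.erase a) ⊆ S :=
    insert_subset hb.1.1 ((erase_subset _ _).trans hAS)
  have hB1 := hsplit _ hBS fun j => by
    rw [card_filter_exchange ha.1 hbA (ha.2.trans hb.1.2.symm), hA]
  have hB2 := crossEdges_sdiff_subset (F := F) hBS
  have hexch := card_le_of_crossEdges_exchange ha.1 (mem_sdiff.2 ⟨hb.1.1, hbA⟩)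
    (eq_of_subset_of_card_le (crossEdges_sdiff_subset (F := F) hAS) (by omega)).ge
    (eq_of_subset_of_card_le hB2 (by omega)).ge
  have hbne : b ∈ S.erase a := mem_erase.2 ⟨fun h => hbA (h ▸ ha.1), hb.1.1⟩
  have hrest : ((S.erase a).erase b).card = 4 := by
    rw [card_erase_of_mem hbne, card_erase_of_mem (hAS ha.1)]
    omega
  have hT := card_edgesWithin_lt hF (T := (S.erase a).erase b) (card_pos.1 (by omega))
  omega
end

section
/- Let F be a forest whose vertices are colored with two colors in ratio 1:1. Then every fair partition of the vertices of F of minimum correlation clustering cost among all fair partitions has all parts of size at most 4 (hence each part has size 2 or 4). -/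
open Finset

/-- A nonempty forest has fewer edges than vertices. -/
theorem SimpleGraph.IsAcyclic.card_edgeFinset_add_one_le {V : Type*} [Fintype V] [Nonempty V]
    {G : SimpleGraph V} [DecidableRel G.Adj] (hG : G.IsAcyclic) :
    #G.edgeFinset + 1 ≤ Fintype.card V := by
  classical
  obtain ⟨T, hle, hT⟩ := SimpleGraph.exists_maximal_isAcyclic_of_le_isAcyclic le_top hG
  have hT' : T.IsTree := SimpleGraph.isTree_iff_maximal_isAcyclic.2
    ⟨inferInstance, by simpa using hT⟩
  rw [← hT'.card_edgeFinset]
  gcongr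

/-- In a forest, the degrees inside a nonempty vertex set `S` sum to less than `2 * #S`. -/
theorem SimpleGraph.IsAcyclic.sum_card_adj_lt {V : Type*} {G : SimpleGraph V}
    [DecidableRel G.Adj] (hG : G.IsAcyclic) {S : Finset V} (hS : S.Nonempty) :
    ∑ v ∈ S, #{w ∈ S | G.Adj v w} < 2 * #S := by
  classical
  have : Nonempty (S : Set V) := hS.to_subtype
  have hcard := (hG.induce (S : Set V)).card_edgeFinset_add_one_le
  have hsum := (G.induce (S : Set V)).sum_degrees_eq_twice_card_edges
  have hdeg (v : (S : Set V)) :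
      (G.induce (S : Set V)).degree v = #{w ∈ S | G.Adj v w} := by
    rw [← SimpleGraph.card_neighborFinset_eq_degree,
      ← card_map (Function.Embedding.subtype (· ∈ (S : Set V)))]
    congr 1
    ext w
    simp [and_comm]
  have hcoe : ∑ v : (S : Set V), #{w ∈ S | G.Adj v w} = ∑ v ∈ S, #{w ∈ S | G.Adj v w} :=
    S.sum_coe_sort fun v ↦ #{w ∈ S | G.Adj v w}
  have hSc : Fintype.card (S : Set V) = #S := Fintype.card_coe S
  simp only [hdeg] at hsum
  omega

/-- If `A` and `B` have the same size and the sum of `f` over both is less than `4 * #A`,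
then `f a + f b ≤ 3` for some `a ∈ A` and `b ∈ B`. -/
theorem Finset.exists_add_le_three_of_sum_lt {V : Type*} {A B : Finset V} (hAB : #A = #B)
    (f : V → ℕ) (h : ∑ v ∈ A, f v + ∑ v ∈ B, f v < 4 * #A) :
    ∃ a ∈ A, ∃ b ∈ B, f a + f b ≤ 3 := by
  have hA : A.Nonempty := card_pos.1 (by omega)
  have hB : B.Nonempty := card_pos.1 (by omega)
  obtain ⟨a, ha, hamin⟩ := exists_min_image A f hA
  obtain ⟨b, hb, hbmin⟩ := exists_min_image B f hB
  refine ⟨a, ha, b, hb, ?_⟩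
  have h₁ := card_nsmul_le_sum A f (f a) hamin
  have h₂ := card_nsmul_le_sum B f (f b) hbmin
  rw [smul_eq_mul] at h₁ h₂
  rw [← hAB] at h₂
  by_contra! h₃
  nlinarith

/-- The partition obtained from `P` by making `A` a part of its own. -/
def Finpartition.splitOff {V : Type*} [Fintype V] [DecidableEq V]
    (P : Finpartition (univ : Finset V)) {A : Finset V} (hA : A ≠ ∅) :
    Finpartition (univ : Finset V) :=
  (P.avoid A).extend hA sdiff_disjoint (by simp)

theorem Finpartition.sameBlock_splitOff {V : Type*} [Fintype V] [DecidableEq V]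
    (P : Finpartition (univ : Finset V)) {A S : Finset V} (hA : A ≠ ∅) (hS : S ∈ P.parts)
    (hAS : A ⊆ S) (u v : V) :
    SameBlock (P.splitOff hA).parts u v ↔ SameBlock P.parts u v ∧ (u ∈ A ↔ v ∈ A) := by
  simp only [SameBlock, splitOff, extend, mem_insert, mem_avoid]
  constructor
  · rintro ⟨T, rfl | ⟨T, hT, -, rfl⟩, hu, hv⟩
    · exact ⟨⟨S, hS, hAS hu, hAS hv⟩, by tauto⟩
    · rw [mem_sdiff] at hu hv
      exact ⟨⟨T, hT, hu.1, hv.1⟩, by tauto⟩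
  · rintro ⟨⟨T, hT, hu, hv⟩, h⟩
    by_cases hu' : u ∈ A
    · exact ⟨A, .inl rfl, hu', h.1 hu'⟩
    · exact ⟨T \ A, .inr ⟨T, hT, fun hle ↦ hu' (hle hu), rfl⟩, by simp [hu, hu'],
        by simp [hv, ← h, hu']⟩

/-- Splitting `A` off its part `S` changes the cost by twice the number of edges between `A` and
`S \ A`, minus the number of pairs between `A` and `S \ A`. -/
theorem ccCost_splitOff_le {V : Type*} [Fintype V] [DecidableEq V] (G : SimpleGraph V)
    [DecidableRel G.Adj] (P : Finpartition (univ : Finset V)) {A S : Finset V} (hA : A ≠ ∅)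
    (hS : S ∈ P.parts) (hAS : A ⊆ S) :
    ccCost G (P.splitOff hA).parts + #A * #(S \ A)
      ≤ ccCost G P.parts + 2 * ∑ a ∈ A, #{w ∈ S \ A | G.Adj a w} := by
  let X : Finset (V × V) := A ×ˢ (S \ A)
  let cut : Finset (V × V) := {p ∈ X | G.Adj p.1 p.2}
  let gap : Finset (V × V) := {p ∈ X | ¬ G.Adj p.1 p.2}
  have hX : #cut + #gap = #A * #(S \ A) := by
    rw [card_filter_add_card_filter_not, card_product]
  have hcut : #cut = ∑ a ∈ A, #{w ∈ S \ A | G.Adj a w} := by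
    simp only [cut, X, card_filter, sum_product]
  have hinj : Set.InjOn (fun p : V × V ↦ s(p.1, p.2)) gap := by
    rintro ⟨a, b⟩ h ⟨c, d⟩ h' heq
    simp only [gap, X, coe_filter, mem_product, mem_sdiff, Set.mem_ofPred_eq] at h h'
    simp only [Sym2.eq_iff] at heq
    rcases heq with ⟨rfl, rfl⟩ | ⟨rfl, rfl⟩
    · rfl
    · tauto
  have hinter : interCost G (P.splitOff hA).parts ≤ interCost G P.parts + #cut := by
    refine (Set.ncard_le_ncard (t := {e : Sym2 V | e ∈ G.edgeSet ∧
      ∃ u ∈ e, ∃ v ∈ e, ¬ SameBlock P.parts u v} ∪ ↑(cut.image fun p ↦ s(p.1, p.2))) ?_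
      (Set.toFinite _)).trans ((Set.ncard_union_le _ _).trans ?_)
    · rintro e ⟨heG, u, hu, v, hv, huv⟩
      rw [P.sameBlock_splitOff hA hS hAS] at huv
      by_cases hP : SameBlock P.parts u v
      · right
        have hne : u ≠ v := by rintro rfl; tauto
        obtain rfl : e = s(u, v) := (Sym2.mem_and_mem_iff hne).1 ⟨hu, hv⟩
        have hadj : G.Adj u v := heG
        have hiff : ¬ (u ∈ A ↔ v ∈ A) := fun h ↦ huv ⟨hP, h⟩
        obtain ⟨T, hT, huT, hvT⟩ := hP
        have hTS {x : V} (hx : x ∈ A) (hxT : x ∈ T) : T = S :=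
          P.eq_of_mem_parts hT hS hxT (hAS hx)
        simp only [cut, X, coe_image, Set.mem_image, mem_coe, mem_filter, mem_product, mem_sdiff]
        by_cases huA : u ∈ A
        · obtain rfl := hTS huA huT
          exact ⟨(u, v), ⟨⟨huA, hvT, fun hvA ↦ hiff (iff_of_true huA hvA)⟩, hadj⟩, rfl⟩
        · have hvA : v ∈ A := by tauto
          obtain rfl := hTS hvA hvT
          exact ⟨(v, u), ⟨⟨hvA, huT, huA⟩, hadj.symm⟩, Sym2.eq_swap⟩
      · exact .inl ⟨heG, u, hu, v, hv, hP⟩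
    · rw [Set.ncard_coe_finset]
      exact Nat.add_le_add_left card_image_le _
  have hintra : intraCost G (P.splitOff hA).parts + #gap ≤ intraCost G P.parts := by
    rw [← card_image_of_injOn hinj, ← Set.ncard_coe_finset, intraCost, intraCost,
      ← Set.ncard_union_eq ?_ (Set.toFinite _) (Set.toFinite _)]
    · refine Set.ncard_le_ncard ?_ (Set.toFinite _)
      rintro e (⟨hd, heG, h⟩ | he)
      · exact ⟨hd, heG, fun u hu v hv ↦
          ((P.sameBlock_splitOff hA hS hAS u v).1 (h u hu v hv)).1⟩
      · obtain ⟨⟨a, b⟩, hp, rfl⟩ := mem_image.1 (mem_coe.1 he)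
        simp only [gap, X, mem_filter, mem_product, mem_sdiff] at hp
        obtain ⟨⟨ha, hbS, hb⟩, hadj⟩ := hp
        have haS := hAS ha
        refine ⟨?_, hadj, ?_⟩
        · rw [Sym2.mk_isDiag_iff]
          exact fun h : a = b ↦ hb (h ▸ ha)
        · intro u hu v hv
          refine ⟨S, hS, ?_, ?_⟩
          · rcases Sym2.mem_iff.1 hu with rfl | rfl <;> assumption
          · rcases Sym2.mem_iff.1 hv with rfl | rfl <;> assumption
    · refine Set.disjoint_left.2 fun e ⟨_, _, h⟩ he ↦ ?_
      obtain ⟨⟨a, b⟩, hp, rfl⟩ := mem_image.1 (mem_coe.1 he)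
      simp only [gap, X, mem_filter, mem_product, mem_sdiff] at hp
      have hab := h a (Sym2.mem_mk_left a b) b (Sym2.mem_mk_right a b)
      rw [P.sameBlock_splitOff hA hS hAS] at hab
      tauto
  simp only [ccCost]
  omega

/-- In a forest with two colors in ratio `1:1`, every fair partition of
minimum correlation clustering cost among all fair partitions has all parts of size at
most 4. -/
theorem stmt3 {V : Type*} [Fintype V] [DecidableEq V]
    (F : SimpleGraph V) (hF : F.IsAcyclic)
    (col : V → Fin 2)
    (hratio : ∀ i : Fin 2,
      (Finset.univ.filter fun v => col v = i).card * 2 = Fintype.card V)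
    (P : Finpartition (Finset.univ : Finset V))
    (hfair : ∀ S ∈ P.parts, FairSet col S)
    (hopt : ∀ Q : Finpartition (Finset.univ : Finset V),
      (∀ S ∈ Q.parts, FairSet col S) → ccCost F P.parts ≤ ccCost F Q.parts) :
    ∀ S ∈ P.parts, S.card ≤ 4 := by
  classical
  intro S hS
  by_contra! hcard
  have hSne : S.Nonempty := P.nonempty_of_mem_parts hS
  have hVpos : 0 < Fintype.card V := Fintype.card_pos_iff.2 ⟨hSne.choose⟩
  have fairSet_iff (T : Finset V) : FairSet col T ↔ ∀ i, 2 * #{v ∈ T | col v = i} = #T := by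
    refine forall_congr' fun i ↦ ?_
    rw [← hratio i] at hVpos ⊢
    have hpos : 0 < #{v | col v = i} := by omega
    refine ⟨fun h ↦ Nat.eq_of_mul_eq_mul_left hpos (by linarith), fun h ↦ ?_⟩
    rw [← h]
    ring
  have hbal := (fairSet_iff S).1 (hfair S hS)
  have hdeg := hF.sum_card_adj_lt hSne
  rw [← sum_filter_add_sum_filter_not S (fun v ↦ col v = 0)] at hdeg
  have hcol : ∀ v, ¬ col v = 0 ↔ col v = 1 := by intro v; omega
  simp only [hcol] at hdeg
  obtain ⟨a, ha, b, hb, hab⟩ := exists_add_le_three_of_sum_lt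
    (by linarith [hbal 0, hbal 1]) _ (hdeg.trans_eq (by linarith [hbal 0]))
  rw [mem_filter] at ha hb
  have hne : a ≠ b := by rintro rfl; simp_all
  have hA : ({a, b} : Finset V) ≠ ∅ := insert_ne_empty _ _
  have hAS : ({a, b} : Finset V) ⊆ S := by simp [insert_subset_iff, ha.1, hb.1]
  have hAbal (i : Fin 2) : 2 * #{v ∈ ({a, b} : Finset V) | col v = i} = #{a, b} := by
    rw [card_pair hne]
    fin_cases i <;> simp [filter_insert, filter_singleton, ha.2, hb.2]
  have hQ : ∀ T ∈ (P.splitOff hA).parts, FairSet col T := by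
    simp only [Finpartition.splitOff, Finpartition.extend, mem_insert, Finpartition.mem_avoid]
    rintro _ (rfl | ⟨T, hT, -, rfl⟩)
    · exact (fairSet_iff _).2 hAbal
    by_cases hTS : T = S
    · rw [hTS]
      refine (fairSet_iff _).2 fun i ↦ ?_
      have h₁ := card_sdiff_add_card_eq_card hAS
      have h₂ := card_sdiff_add_card_eq_card (filter_subset_filter (fun v ↦ col v = i) hAS)
      have h₃ : {v ∈ S \ {a, b} | col v = i} =
          {v ∈ S | col v = i} \ {v ∈ ({a, b} : Finset V) | col v = i} := by grind
      rw [← h₃] at h₂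
      linarith [hbal i, hAbal i]
    · have hdisj : Disjoint T {a, b} := (P.disjoint hT hS hTS).mono_right hAS
      rw [sdiff_eq_self_of_disjoint hdisj]
      exact hfair T hT
  have hle := hopt _ hQ
  have hcost := ccCost_splitOff_le F P hA hS hAS
  have hsize := card_sdiff_add_card_eq_card hAS
  have hcut (v : V) : #{w ∈ S \ {a, b} | F.Adj v w} ≤ #{w ∈ S | F.Adj v w} :=
    card_le_card (filter_subset_filter _ sdiff_subset)
  rw [sum_pair hne] at hcost
  rw [card_pair hne] at hcost hsize
  have := hcut a
  have := hcut b
  have := hbal 0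
  omega
end

section
/- Let F be a forest whose vertices are colored blue and red such that the number of red vertices is exactly twice the number of blue vertices, and suppose every connected component of F contains at most 1 blue vertex and at most 2 red vertices. Let #(br) be the number of connected components consisting of exactly one blue and one red vertex, and #(r) the number of connected components consisting of a single red vertex. Then there exists a set D of exactly max(0, (#(br) − #(r))/2) edges of F such that the connected components of F − D can be grouped so that each group's union contains exactly 1 blue and 2 red vertices; moreover, no set of fewer edges admits such a grouping. -/
open Finset

/-- The number of connected components of `F` consisting of exactly one blue and one
red vertex. -/
noncomputable def brCount {V : Type*} (F : SimpleGraph V) (blue : Finset V) : ℕ :=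
  Nat.card {c : F.ConnectedComponent |
    ({v | F.connectedComponentMk v = c} ∩ ↑blue).ncard = 1 ∧
    ({v | F.connectedComponentMk v = c} \ ↑blue).ncard = 1}

/-- The number of connected components of `F` consisting of a single red vertex. -/
noncomputable def rCount {V : Type*} (F : SimpleGraph V) (blue : Finset V) : ℕ :=
  Nat.card {c : F.ConnectedComponent |
    ({v | F.connectedComponentMk v = c} ∩ ↑blue).ncard = 0 ∧
    ({v | F.connectedComponentMk v = c} \ ↑blue).ncard = 1}

/-- After deleting the edge set `D` from `F`, the connected components of `F - D` can be
grouped so that the union of each group contains exactly 1 blue and 2 red vertices. -/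
def Groupable {V : Type*} [Fintype V] [DecidableEq V] (F : SimpleGraph V)
    (blue : Finset V) (D : Finset (Sym2 V)) : Prop :=
  ∃ Q : Finpartition (Finset.univ : Finset V),
    (∀ u v : V, (F.deleteEdges (↑D : Set (Sym2 V))).Reachable u v → SameBlock Q.parts u v) ∧
    ∀ S ∈ Q.parts,
      (S.filter fun v => v ∈ blue).card = 1 ∧ (S.filter fun v => v ∉ blue).card = 2

/-- The number of blue elements with label `i`. -/
def blueCard {V ι : Type*} [Fintype V] [DecidableEq V] [DecidableEq ι] (blue : Finset V)
    (f : V → ι) (i : ι) : ℕ :=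
  #{v | f v = i ∧ v ∈ blue}

/-- The number of red elements with label `i`. -/
def redCard {V ι : Type*} [Fintype V] [DecidableEq V] [DecidableEq ι] (blue : Finset V)
    (f : V → ι) (i : ι) : ℕ :=
  #{v | f v = i ∧ v ∉ blue}

section Labelling

variable {ι : Type*} [DecidableEq ι] {b r : ι → ℕ} {s : Finset ι}

lemma exists_group (hs : s.Nonempty)
    (htype : ∀ i ∈ s, b i ≤ 1 ∧ r i ≤ 2 ∧ 0 < b i + r i)
    (hsum : ∑ i ∈ s, r i = 2 * ∑ i ∈ s, b i)
    (hrr : #{i ∈ s | b i = 0 ∧ r i = 2} ≤ #{i ∈ s | b i = 1 ∧ r i = 0}) :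
    ∃ t ⊆ s, t.Nonempty ∧ ∑ i ∈ t, b i = 1 ∧ ∑ i ∈ t, r i = 2 ∧
      #{i ∈ s \ t | b i = 0 ∧ r i = 2} ≤ #{i ∈ s \ t | b i = 1 ∧ r i = 0} := by
  by_cases h12 : ∃ x ∈ s, b x = 1 ∧ r x = 2
  · obtain ⟨x, hx, hb, hr⟩ := h12
    refine ⟨{x}, by simpa, by simp, by simpa, by simpa, ?_⟩
    convert hrr using 2 <;> ext i <;> grind
  by_cases h02 : ∃ x ∈ s, b x = 0 ∧ r x = 2
  · obtain ⟨x, hx, hb, hr⟩ := h02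
    have hpos : 0 < #{i ∈ s | b i = 1 ∧ r i = 0} :=
      lt_of_lt_of_le (card_pos.2 ⟨x, by simp [*]⟩) hrr
    obtain ⟨y, hy⟩ := card_pos.1 hpos
    obtain ⟨hy, hb', hr'⟩ := mem_filter.1 hy
    have hxy : x ≠ y := by rintro rfl; omega
    refine ⟨{x, y}, by grind, by simp, by simp [sum_pair hxy, *], by simp [sum_pair hxy, *], ?_⟩
    have e1 : ({i ∈ s \ {x, y} | b i = 0 ∧ r i = 2} : Finset ι) =
        ({i ∈ s | b i = 0 ∧ r i = 2} : Finset ι).erase x := by ext i; grind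
    have e2 : ({i ∈ s \ {x, y} | b i = 1 ∧ r i = 0} : Finset ι) =
        ({i ∈ s | b i = 1 ∧ r i = 0} : Finset ι).erase y := by ext i; grind
    rw [e1, e2, card_erase_of_mem (by simp [*]), card_erase_of_mem (by simp [*])]
    omega
  have hnone : ∀ t : Finset ι, #{i ∈ s \ t | b i = 0 ∧ r i = 2} = 0 := by
    intro t
    rw [card_eq_zero, filter_eq_empty_iff]
    intro i hi h
    exact h02 ⟨i, (mem_sdiff.1 hi).1, h⟩
  by_cases h11 : ∃ x ∈ s, b x = 1 ∧ r x = 1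
  · obtain ⟨x, hx, hb, hr⟩ := h11
    have h01 : ∃ y ∈ s, b y = 0 ∧ r y = 1 := by
      by_contra! hno
      have hle : ∑ i ∈ s, r i ≤ ∑ i ∈ s, b i := sum_le_sum fun i hi => by grind
      have := single_le_sum (f := b) (fun i _ => Nat.zero_le _) hx
      omega
    obtain ⟨y, hy, hb', hr'⟩ := h01
    have hxy : x ≠ y := by rintro rfl; omega
    exact ⟨{x, y}, by grind, by simp, by simp [sum_pair hxy, *], by simp [sum_pair hxy, *],
      by rw [hnone]; exact Nat.zero_le _⟩
  have hle : ∀ i ∈ s, b i = 1 ∧ r i = 0 ∨ b i = 0 ∧ r i = 1 := by grind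
  have h10 : ∃ x ∈ s, b x = 1 ∧ r x = 0 := by
    by_contra! hno
    obtain ⟨x, hx⟩ := hs
    have hb0 : ∑ i ∈ s, b i = 0 := sum_eq_zero fun i hi => by grind
    have := single_le_sum (f := r) (fun i _ => Nat.zero_le _) hx
    grind
  obtain ⟨x, hx, hb, hr⟩ := h10
  have hcard : #{i ∈ s | r i = 1} = ∑ i ∈ s, r i := by
    rw [card_filter]
    exact sum_congr rfl fun i hi => by grind
  have := single_le_sum (f := b) (fun i _ => Nat.zero_le _) hx
  obtain ⟨y, hy, z, hz, hyz⟩ := one_lt_card.1 (show 1 < #{i ∈ s | r i = 1} by omega)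
  rw [mem_filter] at hy hz
  have hxy : x ∉ ({y, z} : Finset ι) := by grind
  refine ⟨{x, y, z}, by grind, by simp, ?_, ?_, by rw [hnone]; exact Nat.zero_le _⟩ <;>
  · rw [sum_insert hxy, sum_pair hyz]
    grind

lemma exists_labelling
    (htype : ∀ i ∈ s, b i ≤ 1 ∧ r i ≤ 2 ∧ 0 < b i + r i)
    (hsum : ∑ i ∈ s, r i = 2 * ∑ i ∈ s, b i)
    (hrr : #{i ∈ s | b i = 0 ∧ r i = 2} ≤ #{i ∈ s | b i = 1 ∧ r i = 0}) :
    ∃ g : ι → ι, ∀ i ∈ s, g i ∈ s ∧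
      ∑ j ∈ s with g j = g i, b j = 1 ∧ ∑ j ∈ s with g j = g i, r j = 2 := by
  induction s using Finset.strongInduction with
  | H s ih =>
    rcases s.eq_empty_or_nonempty with rfl | hs
    · exact ⟨id, by simp⟩
    obtain ⟨t, hts, ⟨x, hx⟩, hb, hr, hrr'⟩ := exists_group hs htype hsum hrr
    have hb' := sum_sdiff (f := b) hts
    have hr' := sum_sdiff (f := r) hts
    obtain ⟨g, hg⟩ := ih (s \ t) (sdiff_ssubset hts ⟨x, hx⟩)
      (fun i hi => htype i (mem_sdiff.1 hi).1) (by omega) hrr'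
    refine ⟨fun i => if i ∈ t then x else g i, fun i hi => ?_⟩
    by_cases hit : i ∈ t
    · have e : ({j ∈ s | (if j ∈ t then x else g j) = if i ∈ t then x else g i} : Finset ι) =
          t := by
        ext j; grind
      rw [e]
      exact ⟨by grind, hb, hr⟩
    · have e : ({j ∈ s | (if j ∈ t then x else g j) = if i ∈ t then x else g i} : Finset ι) =
          {j ∈ s \ t | g j = g i} := by
        ext j; grind
      rw [e]
      exact ⟨by grind, (hg i (by grind)).2⟩

end Labelling

section Cards

variable {V ι κ : Type*} [Fintype V] [DecidableEq V] [DecidableEq ι] [DecidableEq κ]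
  (blue : Finset V) (f : V → ι)

lemma sum_blueCard {s : Finset ι} (hs : ∀ v, f v ∈ s) (g : ι → κ) (k : κ) :
    ∑ i ∈ s with g i = k, blueCard blue f i = #{v | g (f v) = k ∧ v ∈ blue} := by
  rw [card_eq_sum_card_fiberwise (f := f) (t := {i ∈ s | g i = k})
    (fun v hv => by simp_all)]
  refine sum_congr rfl fun i hi => congrArg card ?_
  ext v; grind

lemma sum_redCard {s : Finset ι} (hs : ∀ v, f v ∈ s) (g : ι → κ) (k : κ) :
    ∑ i ∈ s with g i = k, redCard blue f i = #{v | g (f v) = k ∧ v ∉ blue} := by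
  rw [card_eq_sum_card_fiberwise (f := f) (t := {i ∈ s | g i = k})
    (fun v hv => by simp_all)]
  refine sum_congr rfl fun i hi => congrArg card ?_
  ext v; grind

lemma sum_redCard_eq_two_mul (hratio : (univ \ blue).card = 2 * blue.card)
    {s : Finset ι} (hs : ∀ v, f v ∈ s) :
    ∑ i ∈ s, redCard blue f i = 2 * ∑ i ∈ s, blueCard blue f i := by
  have h1 := sum_blueCard blue f hs (fun _ => ()) ()
  have h2 := sum_redCard blue f hs (fun _ => ()) ()
  simp only [filter_true, true_and, filter_univ_mem] at h1 h2
  rw [h1, h2, ← hratio]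
  congr 1
  ext v; simp

lemma blueCard_add_redCard_pos (v : V) : 0 < blueCard blue f (f v) + redCard blue f (f v) := by
  by_cases hv : v ∈ blue
  · exact Nat.add_pos_left (card_pos.2 ⟨v, by simp [hv]⟩) _
  · exact Nat.add_pos_right _ (card_pos.2 ⟨v, by simp [hv]⟩)

lemma ncard_inter_eq_blueCard (i : ι) :
    ({v | f v = i} ∩ ↑blue : Set V).ncard = blueCard blue f i := by
  rw [blueCard, ← Set.ncard_coe_finset]
  congr 1
  ext v; simp

lemma ncard_diff_eq_redCard (i : ι) :
    ({v | f v = i} \ ↑blue : Set V).ncard = redCard blue f i := by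
  rw [redCard, ← Set.ncard_coe_finset]
  congr 1
  ext v; simp

end Cards

section Forest

variable {V : Type*} [Fintype V] [DecidableEq V] {F : SimpleGraph V} {blue : Finset V}
  {D : Finset (Sym2 V)}

/-- A grouping is obtained from a labelling of pieces that are unions of components. -/
lemma groupable_of_labelling {ι : Type*} [DecidableEq ι] (f : V → ι)
    (hf : ∀ u v, (F.deleteEdges (↑D : Set (Sym2 V))).Adj u v → f u = f v)
    (hratio : (univ \ blue).card = 2 * blue.card)
    (hle : ∀ v, blueCard blue f (f v) ≤ 1 ∧ redCard blue f (f v) ≤ 2)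
    (hrr : #{i ∈ univ.image f | blueCard blue f i = 0 ∧ redCard blue f i = 2} ≤
      #{i ∈ univ.image f | blueCard blue f i = 1 ∧ redCard blue f i = 0}) :
    Groupable F blue D := by
  have hs : ∀ v, f v ∈ univ.image f := fun v => mem_image_of_mem f (mem_univ v)
  obtain ⟨g, hg⟩ := exists_labelling (s := univ.image f)
    (by
      intro i hi
      obtain ⟨v, -, rfl⟩ := mem_image.1 hi
      exact ⟨(hle v).1, (hle v).2, blueCard_add_redCard_pos blue f v⟩)
    (sum_redCard_eq_two_mul blue f hratio hs) hrr
  have hreach : ∀ u v, (F.deleteEdges (↑D : Set (Sym2 V))).Reachable u v → f u = f v := by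
    rintro u v ⟨p⟩
    induction p with
    | nil => rfl
    | cons h _ ih => exact (hf _ _ h).trans ih
  let σ : Setoid V := Setoid.ker (g ∘ f)
  have : DecidableRel σ.r := fun u v => decEq (g (f u)) (g (f v))
  let Q := Finpartition.ofSetoid σ
  have hpart : ∀ u v, v ∈ Q.part u ↔ g (f u) = g (f v) := fun u v =>
    Finpartition.mem_part_ofSetoid_iff_rel
  refine ⟨Q, fun u v huv => ⟨Q.part u, Q.part_mem.2 (mem_univ u), ?_, ?_⟩, fun S hS => ?_⟩
  · exact (hpart u u).2 rfl
  · exact (hpart u v).2 (by rw [hreach u v huv])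
  · obtain ⟨u, hu⟩ := Q.nonempty_of_mem_parts hS
    obtain rfl := Q.part_eq_of_mem hS hu
    obtain ⟨-, h1, h2⟩ := hg (f u) (hs u)
    rw [sum_blueCard blue f hs] at h1
    rw [sum_redCard blue f hs] at h2
    refine ⟨h1 ▸ congrArg card ?_, h2 ▸ congrArg card ?_⟩ <;> ext v <;> simp [hpart, eq_comm]

variable [DecidableEq F.ConnectedComponent]

lemma exists_adj_of_redCard_eq_two {c : F.ConnectedComponent}
    (hb : blueCard blue F.connectedComponentMk c = 0)
    (hr : redCard blue F.connectedComponentMk c = 2) :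
    ∃ u v, F.Adj u v ∧ ∀ w, F.connectedComponentMk w = c ↔ w = u ∨ w = v := by
  obtain ⟨u, v, huv, h⟩ := card_eq_two.1 hr
  have hmem : ∀ w, F.connectedComponentMk w = c ↔ w = u ∨ w = v := by
    intro w
    have h1 : w ∉ ({v | F.connectedComponentMk v = c ∧ v ∈ blue} : Finset V) := by
      rw [card_eq_zero.1 hb]; simp
    have h2 := congrArg (w ∈ ·) h
    simp at h1 h2
    grind
  refine ⟨u, v, ?_, hmem⟩
  have hreach : F.Reachable u v := SimpleGraph.ConnectedComponent.exact
    (((hmem u).2 (.inl rfl)).trans ((hmem v).2 (.inr rfl)).symm)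
  obtain ⟨p⟩ := hreach
  cases p with
  | nil => exact absurd rfl huv
  | @cons _ w _ hadj q =>
    have hw := (hmem w).1
      ((SimpleGraph.ConnectedComponent.connectedComponentMk_eq_of_adj hadj).symm.trans ((hmem u).2 (.inl rfl)))
    rcases hw with rfl | rfl
    · exact absurd rfl hadj.ne
    · exact hadj

variable [Fintype F.ConnectedComponent]

lemma brCount_eq : brCount F blue = #{c | blueCard blue F.connectedComponentMk c = 1 ∧
    redCard blue F.connectedComponentMk c = 1} := by
  simp only [brCount, ncard_inter_eq_blueCard, ncard_diff_eq_redCard]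
  rw [Nat.card_coe_set_eq, ← Set.ncard_coe_finset]
  congr 1
  ext c; simp

lemma rCount_eq : rCount F blue = #{c | blueCard blue F.connectedComponentMk c = 0 ∧
    redCard blue F.connectedComponentMk c = 1} := by
  simp only [rCount, ncard_inter_eq_blueCard, ncard_diff_eq_redCard]
  rw [Nat.card_coe_set_eq, ← Set.ncard_coe_finset]
  congr 1
  ext c; simp

/-- Half the excess of br-components over r-components is the excess of components with two red
vertices over isolated blue vertices. -/
lemma brCount_sub_rCount_half (hratio : (univ \ blue).card = 2 * blue.card)
    (hle : ∀ c, blueCard blue F.connectedComponentMk c ≤ 1 ∧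
      redCard blue F.connectedComponentMk c ≤ 2) :
    (brCount F blue - rCount F blue) / 2 =
      #{c | blueCard blue F.connectedComponentMk c = 0 ∧
        redCard blue F.connectedComponentMk c = 2} -
      #{c | blueCard blue F.connectedComponentMk c = 1 ∧
        redCard blue F.connectedComponentMk c = 0} := by
  have hsum := sum_redCard_eq_two_mul blue F.connectedComponentMk hratio
    (s := univ) (fun _ => mem_univ _)
  rw [brCount_eq, rCount_eq]
  have key : ∑ c, redCard blue F.connectedComponentMk c +
      2 * #{c | blueCard blue F.connectedComponentMk c = 1 ∧
        redCard blue F.connectedComponentMk c = 0} +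
      #{c | blueCard blue F.connectedComponentMk c = 1 ∧
        redCard blue F.connectedComponentMk c = 1} =
      2 * ∑ c, blueCard blue F.connectedComponentMk c +
      #{c | blueCard blue F.connectedComponentMk c = 0 ∧
        redCard blue F.connectedComponentMk c = 1} +
      2 * #{c | blueCard blue F.connectedComponentMk c = 0 ∧
        redCard blue F.connectedComponentMk c = 2} := by
    simp only [card_filter, mul_sum, ← sum_add_distrib]
    refine sum_congr rfl fun c _ => ?_
    obtain ⟨v, rfl⟩ := c.exists_rep
    have hpos := blueCard_add_redCard_pos blue F.connectedComponentMk v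
    have h := hle (F.connectedComponentMk v)
    change 0 < blueCard blue F.connectedComponentMk (Quot.mk _ v) +
      redCard blue F.connectedComponentMk (Quot.mk _ v) at hpos
    change blueCard blue F.connectedComponentMk (Quot.mk _ v) ≤ 1 ∧
      redCard blue F.connectedComponentMk (Quot.mk _ v) ≤ 2 at h
    generalize blueCard blue F.connectedComponentMk (Quot.mk _ v) = x at *
    generalize redCard blue F.connectedComponentMk (Quot.mk _ v) = y at *
    obtain ⟨h1, h2⟩ := h
    interval_cases x <;> interval_cases y <;> simp_all
  omega

/-- Splitting the excess components with two red vertices makes the graph groupable. -/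
lemma exists_groupable (hratio : (univ \ blue).card = 2 * blue.card)
    (hle : ∀ c, blueCard blue F.connectedComponentMk c ≤ 1 ∧
      redCard blue F.connectedComponentMk c ≤ 2) :
    ∃ D : Finset (Sym2 V), ↑D ⊆ F.edgeSet ∧
      D.card = #{c | blueCard blue F.connectedComponentMk c = 0 ∧
          redCard blue F.connectedComponentMk c = 2} -
        #{c | blueCard blue F.connectedComponentMk c = 1 ∧
          redCard blue F.connectedComponentMk c = 0} ∧ Groupable F blue D := by
  set RR : Finset F.ConnectedComponent := {c | blueCard blue F.connectedComponentMk c = 0 ∧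
    redCard blue F.connectedComponentMk c = 2} with hRR
  set B : Finset F.ConnectedComponent := {c | blueCard blue F.connectedComponentMk c = 1 ∧
    redCard blue F.connectedComponentMk c = 0} with hB
  obtain ⟨K, hKR, hK⟩ := exists_subset_card_eq (Nat.sub_le #RR #B)
  have hedge : ∀ c : F.ConnectedComponent, ∃ e : Sym2 V, c ∈ RR →
      e ∈ F.edgeSet ∧ (∀ w, F.connectedComponentMk w = c ↔ w ∈ e) := by
    intro c
    by_cases hc : c ∈ RR
    · obtain ⟨hb, hr⟩ := (mem_filter.1 hc).2
      obtain ⟨u, v, huv, h⟩ := exists_adj_of_redCard_eq_two hb hr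
      exact ⟨s(u, v), fun _ => ⟨huv, by simpa using h⟩⟩
    · obtain ⟨v, rfl⟩ := c.exists_rep
      exact ⟨s(v, v), fun h => absurd h hc⟩
  choose e he using hedge
  have hinj : Set.InjOn e K := by
    intro c hc d hd hcd
    obtain ⟨v, hv⟩ := c.exists_rep
    have h1 := ((he c (hKR hc)).2 v).1 hv
    rw [hcd] at h1
    exact hv.symm.trans (((he d (hKR hd)).2 v).2 h1)
  refine ⟨K.image e, ?_, by rw [card_image_of_injOn hinj, hK], ?_⟩
  · intro x hx
    obtain ⟨c, hc, rfl⟩ := mem_image.1 (mem_coe.1 hx)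
    exact (he c (hKR hc)).1
  let f : V → V ⊕ F.ConnectedComponent := fun v =>
    if F.connectedComponentMk v ∈ K then .inl v else .inr (F.connectedComponentMk v)
  have hfl : ∀ v w, f v = .inl w ↔ v = w ∧ F.connectedComponentMk v ∈ K := by
    intro v w; simp only [f]; split_ifs with h <;> simp [h]
  have hfr : ∀ v c, f v = .inr c ↔ F.connectedComponentMk v = c ∧ c ∉ K := by
    intro v c; simp only [f]; split_ifs with h <;> grind
  have hbr : ∀ c ∉ K, blueCard blue f (.inr c) = blueCard blue F.connectedComponentMk c := by
    intro c hc; simp [blueCard, hfr, hc]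
  have hrr : ∀ c ∉ K, redCard blue f (.inr c) = redCard blue F.connectedComponentMk c := by
    intro c hc; simp [redCard, hfr, hc]
  have hone : ∀ w, #{v | f v = .inl w} ≤ 1 := by
    intro w
    rw [card_le_one]
    intro a ha b hb
    grind
  have hbl : ∀ w, blueCard blue f (.inl w) ≤ 1 := fun w =>
    (card_le_card (fun v hv => by grind)).trans (hone w)
  have hrl : ∀ w, redCard blue f (.inl w) ≤ 1 := fun w =>
    (card_le_card (fun v hv => by grind)).trans (hone w)
  have hlred : ∀ v w, f v = .inl w → v ∉ blue := by
    intro v w hvw hv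
    have hb := (mem_filter.1 (hKR ((hfl v w).1 hvw).2)).2.1
    rw [blueCard, card_eq_zero, filter_eq_empty_iff] at hb
    exact hb (mem_univ v) ⟨rfl, hv⟩
  have hbl0 : ∀ w, blueCard blue f (.inl w) = 0 := by
    intro w
    rw [blueCard, card_eq_zero, filter_eq_empty_iff]
    exact fun v _ h => hlred v w h.1 h.2
  refine groupable_of_labelling f ?_ hratio ?_ ?_
  · intro u v huv
    rw [SimpleGraph.deleteEdges_adj] at huv
    have hc := SimpleGraph.ConnectedComponent.connectedComponentMk_eq_of_adj huv.1
    by_cases hu : F.connectedComponentMk u ∈ K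
    · have h := he _ (hKR hu)
      refine absurd (mem_coe.2 (mem_image.2 ⟨_, hu, ?_⟩)) huv.2
      exact ((Sym2.mem_and_mem_iff huv.1.ne).1 ⟨(h.2 u).1 rfl, (h.2 v).1 hc.symm⟩)
    · simp only [f, hc] at hu ⊢
      simp [hu]
  · intro v
    rcases h : f v with w | c
    · exact ⟨hbl w, (hrl w).trans one_le_two⟩
    · rw [hbr c ((hfr v c).1 h).2, hrr c ((hfr v c).1 h).2]
      exact hle c
  · calc #{i ∈ univ.image f | blueCard blue f i = 0 ∧ redCard blue f i = 2}
        ≤ #((RR \ K).image (Sum.inr : _ → V ⊕ F.ConnectedComponent)) := by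
          refine card_le_card fun i hi => ?_
          obtain ⟨hi, h0, h2⟩ := mem_filter.1 hi
          obtain ⟨v, -, hv⟩ := mem_image.1 hi
          rcases i with w | c
          · have := hrl w
            omega
          · have hc := ((hfr v c).1 hv).2
            rw [hbr c hc] at h0
            rw [hrr c hc] at h2
            exact mem_image_of_mem _ (mem_sdiff.2 ⟨by simp [hRR, h0, h2], hc⟩)
      _ ≤ #(RR \ K) := card_image_le
      _ ≤ #B := by
          rw [card_sdiff_of_subset hKR, hK]
          omega
      _ = #(B.image (Sum.inr : _ → V ⊕ F.ConnectedComponent)) :=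
          (card_image_of_injective _ Sum.inr_injective).symm
      _ ≤ _ := by
          refine card_le_card fun i hi => ?_
          obtain ⟨c, hc, rfl⟩ := mem_image.1 hi
          obtain ⟨h1, h0⟩ := (mem_filter.1 hc).2
          have hcK : c ∉ K := fun h => by
            have := (mem_filter.1 (hKR h)).2.1
            omega
          obtain ⟨v, hv⟩ := c.exists_rep
          rw [mem_filter, hbr c hcK, hrr c hcK]
          exact ⟨mem_image.2 ⟨v, mem_univ v, (hfr v c).2 ⟨hv, hcK⟩⟩, h1, h0⟩

/-- Each component with two red vertices is either cut or uses up an isolated blue vertex. -/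
lemma card_le_of_groupable (hQ : Groupable F blue D)
    (hle : ∀ c, blueCard blue F.connectedComponentMk c ≤ 1) :
    #{c | blueCard blue F.connectedComponentMk c = 0 ∧
        redCard blue F.connectedComponentMk c = 2} ≤
      #{c | blueCard blue F.connectedComponentMk c = 1 ∧
        redCard blue F.connectedComponentMk c = 0} + #D := by
  obtain ⟨Q, hreach, hQ⟩ := hQ
  set RR : Finset F.ConnectedComponent := {c | blueCard blue F.connectedComponentMk c = 0 ∧
    redCard blue F.connectedComponentMk c = 2} with hRR
  set B : Finset F.ConnectedComponent := {c | blueCard blue F.connectedComponentMk c = 1 ∧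
    redCard blue F.connectedComponentMk c = 0} with hB
  let C : Finset F.ConnectedComponent := D.image fun e => F.connectedComponentMk e.out.1
  have hadj : ∀ u v, F.Adj u v → F.connectedComponentMk u ∉ C →
      (F.deleteEdges (↑D : Set (Sym2 V))).Adj u v := by
    intro u v huv hu
    rw [SimpleGraph.deleteEdges_adj]
    refine ⟨huv, fun hmem => hu (mem_image.2 ⟨_, mem_coe.1 hmem, ?_⟩)⟩
    rcases Sym2.mem_iff.1 (Sym2.out_fst_mem s(u, v)) with h | h <;> rw [h]
    exact (SimpleGraph.ConnectedComponent.connectedComponentMk_eq_of_adj huv).symm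
  have hwalk : ∀ u v, F.Reachable u v → F.connectedComponentMk u ∉ C →
      (F.deleteEdges (↑D : Set (Sym2 V))).Reachable u v := by
    rintro u v ⟨p⟩ hu
    induction p with
    | nil => rfl
    | cons h _ ih =>
      refine (hadj _ _ h hu).reachable.trans (ih ?_)
      rwa [← SimpleGraph.ConnectedComponent.connectedComponentMk_eq_of_adj h]
  have hblock : ∀ u v, ∀ S ∈ Q.parts, F.connectedComponentMk u = F.connectedComponentMk v →
      F.connectedComponentMk u ∉ C → u ∈ S → v ∈ S := by
    intro u v S hS huv hu huS
    obtain ⟨T, hT, huT, hvT⟩ := hreach u v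
      (hwalk u v (SimpleGraph.ConnectedComponent.exact huv) hu)
    rwa [Q.eq_of_mem_parts hS hT huS huT]
  have hex : ∀ c : F.ConnectedComponent, ∃ w, c ∈ RR → c ∉ C → ∃ S ∈ Q.parts,
      w ∈ S ∧ w ∈ blue ∧ (∀ x ∈ S, x ∉ blue → F.connectedComponentMk x = c) ∧
        ∃ x ∈ S, F.connectedComponentMk x = c ∧ x ∉ blue := by
    intro c
    obtain ⟨u, hu⟩ := c.exists_rep
    by_cases hc : c ∈ RR ∧ c ∉ C
    swap
    · exact ⟨u, fun h1 h2 => absurd ⟨h1, h2⟩ hc⟩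
    have hS : Q.part u ∈ Q.parts := Q.part_mem.2 (mem_univ u)
    have huS : u ∈ Q.part u := Q.mem_part (mem_univ u)
    obtain ⟨h1, h2⟩ := hQ _ hS
    obtain ⟨w, hw⟩ := card_pos.1 (h1.symm ▸ one_pos)
    rw [mem_filter] at hw
    have hcu : F.connectedComponentMk u = c := hu
    have hred := (mem_filter.1 hc.1).2.2
    have heq := eq_of_subset_of_card_le
      (s := ({v | F.connectedComponentMk v = c ∧ v ∉ blue} : Finset V))
      (t := {v ∈ Q.part u | v ∉ blue})
      (fun x hx => by
        obtain ⟨-, hxc, hxb⟩ := mem_filter.1 hx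
        exact mem_filter.2 ⟨hblock u x _ hS (hcu.trans hxc.symm) (hcu ▸ hc.2) huS, hxb⟩)
      (by rw [h2]; exact hred.ge)
    obtain ⟨x, hx⟩ := card_pos.1 (show 0 < redCard blue F.connectedComponentMk c by omega)
    refine ⟨w, fun _ _ => ⟨_, hS, hw.1, hw.2, fun y hy hyb => ?_, x, ?_, (mem_filter.1 hx).2⟩⟩
    · have : y ∈ ({v ∈ Q.part u | v ∉ blue} : Finset V) := mem_filter.2 ⟨hy, hyb⟩
      rw [← heq] at this
      exact (mem_filter.1 this).2.1
    · rw [heq] at hx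
      exact (mem_filter.1 hx).1
  choose w hw using hex
  have huncut : #(RR \ C) ≤ #(B ∪ {c ∈ C | blueCard blue F.connectedComponentMk c = 1}) := by
    refine card_le_card_of_injOn (fun c => F.connectedComponentMk (w c)) ?_ ?_
    · intro c hc
      obtain ⟨hcR, hcC⟩ := mem_sdiff.1 hc
      obtain ⟨S, hS, hwS, hwb, hSc, -⟩ := hw c hcR hcC
      have hpos : 0 < blueCard blue F.connectedComponentMk (F.connectedComponentMk (w c)) :=
        card_pos.2 ⟨w c, by simp [hwb]⟩
      have hone := (hle (F.connectedComponentMk (w c))).antisymm hpos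
      by_cases hcut : F.connectedComponentMk (w c) ∈ C
      · exact mem_union_right _ (mem_filter.2 ⟨hcut, hone⟩)
      refine mem_union_left _ (mem_filter.2 ⟨mem_univ _, hone, ?_⟩)
      rw [redCard, card_eq_zero, filter_eq_empty_iff]
      rintro x - ⟨hx, hxb⟩
      have hxc := hSc x (hblock (w c) x S hS hx.symm hcut hwS) hxb
      have h0 := (mem_filter.1 hcR).2.1
      rw [← hxc, hx] at h0
      exact hpos.ne' h0
    · intro c hc d hd hcd
      obtain ⟨hcR, hcC⟩ := mem_sdiff.1 hc
      obtain ⟨hdR, hdC⟩ := mem_sdiff.1 hd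
      obtain ⟨S, hS, hwS, hwb, hSc, x, hx, hxc, hxb⟩ := hw c hcR hcC
      obtain ⟨T, hT, hwT, hwb', hTd, -⟩ := hw d hdR hdC
      have hww : w c = w d := card_le_one.1 (hle (F.connectedComponentMk (w d))) _
        (mem_filter.2 ⟨mem_univ _, hcd, hwb⟩) _ (mem_filter.2 ⟨mem_univ _, rfl, hwb'⟩)
      rw [← hww] at hwT
      obtain rfl := Q.eq_of_mem_parts hS hT hwS hwT
      exact hxc.symm.trans (hTd x hx hxb)
  have hcut : #(RR ∩ C) ≤ #{c ∈ C | ¬ blueCard blue F.connectedComponentMk c = 1} := by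
    refine card_le_card fun c hc => ?_
    obtain ⟨hcR, hcC⟩ := mem_inter.1 hc
    have h0 := (mem_filter.1 hcR).2.1
    exact mem_filter.2 ⟨hcC, by omega⟩
  have hC : #C ≤ #D := card_image_le
  have h1 := card_sdiff_add_card_inter RR C
  have h2 := card_filter_add_card_filter_not (s := C)
    (fun c => blueCard blue F.connectedComponentMk c = 1)
  have h3 := card_union_le B {c ∈ C | blueCard blue F.connectedComponentMk c = 1}
  omega

end Forest

/-- In a forest with twice as many red as blue vertices, all of whose
components have at most 1 blue and at most 2 red vertices, exactly
`max(0, (#(br) - #(r))/2)` edge deletions are necessary and sufficient to be able to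
group the resulting components into groups of exactly 1 blue and 2 red vertices. -/
theorem stmt5 {V : Type*} [Fintype V] [DecidableEq V]
    (F : SimpleGraph V) (hF : F.IsAcyclic)
    (blue : Finset V)
    (hratio : (Finset.univ \ blue).card = 2 * blue.card)
    (hcomp : ∀ c : F.ConnectedComponent,
      ({v | F.connectedComponentMk v = c} ∩ ↑blue).ncard ≤ 1 ∧
      ({v | F.connectedComponentMk v = c} \ ↑blue).ncard ≤ 2) :
    (∃ D : Finset (Sym2 V), ↑D ⊆ F.edgeSet ∧
        D.card = (brCount F blue - rCount F blue) / 2 ∧ Groupable F blue D) ∧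
    ∀ D : Finset (Sym2 V), ↑D ⊆ F.edgeSet → Groupable F blue D →
        (brCount F blue - rCount F blue) / 2 ≤ D.card := by
  classical
  have : Fintype F.ConnectedComponent := Fintype.ofFinite _
  simp only [ncard_inter_eq_blueCard, ncard_diff_eq_redCard] at hcomp
  rw [brCount_sub_rCount_half hratio hcomp]
  refine ⟨exists_groupable hratio hcomp, fun D _ hQ => ?_⟩
  have := card_le_of_groupable hQ fun c => (hcomp c).1
  omega
end

section
/- Let k ≥ 3 and let P be a path on 2k vertices colored with k colors such that each color appears on exactly two vertices. Then every minimum-cost fair partition of the vertices of P consists of exactly two parts, each containing exactly one vertex of each color; moreover, a partition of the vertices into two parts, each containing exactly one vertex of each color, has minimum correlation clustering cost among all fair partitions if and only if it minimizes the number of edges of P with endpoints in different parts among all such two-part partitions. -/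
open Finset

theorem ncard_sameBlock_pairs {V : Type*} [Fintype V] [DecidableEq V]
    (P : Finpartition (Finset.univ : Finset V)) :
    {e : Sym2 V | ¬ e.IsDiag ∧ ∀ u ∈ e, ∀ v ∈ e, SameBlock P.parts u v}.ncard
      = ∑ S ∈ P.parts, S.card.choose 2 := by
  have h : {e : Sym2 V | ¬ e.IsDiag ∧ ∀ u ∈ e, ∀ v ∈ e, SameBlock P.parts u v}
      = ↑(P.parts.biUnion fun S => S.offDiag.image Sym2.mk.uncurry) := by
    ext e
    induction e using Sym2.ind with
    | h x y =>
      simp only [Set.mem_ofPred_eq, Sym2.mk_isDiag_iff, Sym2.mem_iff, SetLike.mem_coe,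
        mem_biUnion, mem_image, mem_offDiag, Prod.exists, Function.uncurry_apply_pair,
        Sym2.eq_iff]
      constructor
      · rintro ⟨hxy, h⟩
        obtain ⟨S, hS, hx, hy⟩ := h x (Or.inl rfl) y (Or.inr rfl)
        exact ⟨S, hS, x, y, ⟨hx, hy, hxy⟩, Or.inl ⟨rfl, rfl⟩⟩
      · rintro ⟨S, hS, a, b, ⟨ha, hb, hab⟩, ⟨rfl, rfl⟩ | ⟨rfl, rfl⟩⟩
        · refine ⟨hab, ?_⟩
          rintro u (rfl | rfl) v (rfl | rfl) <;> exact ⟨S, hS, by assumption, by assumption⟩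
        · refine ⟨Ne.symm hab, ?_⟩
          rintro u (rfl | rfl) v (rfl | rfl) <;> exact ⟨S, hS, by assumption, by assumption⟩
  rw [h, Set.ncard_coe_finset, card_biUnion]
  · exact sum_congr rfl fun S _ => Sym2.card_image_offDiag S
  · intro S hS T hT hST
    rw [Function.onFun, Finset.disjoint_left]
    simp only [mem_image, mem_offDiag, Prod.exists, Function.uncurry_apply_pair]
    rintro _ ⟨a, b, ⟨ha, hb, -⟩, rfl⟩ ⟨c, d, ⟨hc, hd, -⟩, h⟩
    refine hST ?_
    rcases Sym2.eq_iff.1 h with ⟨rfl, rfl⟩ | ⟨rfl, rfl⟩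
    · exact P.eq_of_mem_parts hS hT ha hc
    · exact P.eq_of_mem_parts hS hT ha hd

theorem ccCost_add_ncard_edgeSet {V : Type*} [Fintype V] [DecidableEq V] (G : SimpleGraph V)
    (P : Finpartition (Finset.univ : Finset V)) :
    ccCost G P.parts + G.edgeSet.ncard
      = ∑ S ∈ P.parts, S.card.choose 2 + 2 * interCost G P.parts := by
  set A : Set (Sym2 V) := {e | e ∈ G.edgeSet ∧ ∀ u ∈ e, ∀ v ∈ e, SameBlock P.parts u v} with hA
  have hW : intraCost G P.parts + A.ncard = ∑ S ∈ P.parts, S.card.choose 2 := by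
    rw [← ncard_sameBlock_pairs, intraCost, ← Set.ncard_union_eq]
    · congr 1
      ext e
      have : e ∈ G.edgeSet → ¬ e.IsDiag := G.not_isDiag_of_mem_edgeSet
      simp only [hA, Set.mem_union, Set.mem_ofPred_eq]
      tauto
    · rw [Set.disjoint_left]
      exact fun e h h' => h.2.1 h'.1
  have hE : interCost G P.parts + A.ncard = G.edgeSet.ncard := by
    rw [interCost, ← Set.ncard_union_eq]
    · congr 1
      ext e
      simp only [hA, Set.mem_union, Set.mem_ofPred_eq, ← and_or_left, and_iff_left_iff_imp]
      intro _
      by_cases h : ∀ u ∈ e, ∀ v ∈ e, SameBlock P.parts u v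
      · exact Or.inr h
      · push Not at h
        exact Or.inl h
    · rw [Set.disjoint_left]
      rintro e ⟨-, u, hu, v, hv, h⟩ ⟨-, h'⟩
      exact h (h' u hu v hv)
  rw [ccCost]
  omega

theorem ncard_edgeSet_pathGraph_lt (n : ℕ) (hn : 0 < n) :
    (SimpleGraph.pathGraph n).edgeSet.ncard < n := by
  obtain ⟨m, rfl⟩ := Nat.exists_eq_succ_of_ne_zero hn.ne'
  have hsub : (SimpleGraph.pathGraph (m + 1)).edgeSet
      ⊆ ↑((Finset.univ : Finset (Fin m)).image fun i => s(i.castSucc, i.succ)) := by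
    intro e
    induction e using Sym2.ind with
    | h x y =>
      simp only [SimpleGraph.mem_edgeSet, SimpleGraph.pathGraph_adj, SetLike.mem_coe, mem_image,
        mem_univ, true_and, Sym2.eq_iff, Fin.ext_iff, Fin.val_castSucc, Fin.val_succ]
      rintro (h | h)
      · exact ⟨⟨x, by omega⟩, by dsimp only; omega⟩
      · exact ⟨⟨y, by omega⟩, by dsimp only; omega⟩
  have h := Set.ncard_le_ncard hsub
  rw [Set.ncard_coe_finset] at h
  have := Finset.card_image_le (s := (Finset.univ : Finset (Fin m)))
    (f := fun i => s(i.castSucc, i.succ))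
  rw [Finset.card_univ, Fintype.card_fin] at this
  exact Nat.lt_succ_of_le (h.trans this)

theorem interCost_lt_ncard_edgeSet {V : Type*} [Finite V] {G : SimpleGraph V}
    {P : Finset (Finset V)} {S : Finset V} (hS : S ∈ P) {a b : V} (hab : G.Adj a b)
    (ha : a ∈ S) (hb : b ∈ S) : interCost G P < G.edgeSet.ncard := by
  refine Set.ncard_lt_ncard (Set.ssubset_iff_of_subset (fun e he => he.1) |>.2
    ⟨s(a, b), hab, ?_⟩)
  rintro ⟨-, u, hu, v, hv, h⟩
  rw [Sym2.mem_iff] at hu hv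
  refine h ⟨S, hS, ?_, ?_⟩
  · rcases hu with rfl | rfl <;> assumption
  · rcases hv with rfl | rfl <;> assumption

section Coloring

variable {V : Type*} {k : ℕ} {col : V → Fin k}

theorem card_eq_mul_of_card_color_eq {S : Finset V} {m : ℕ}
    (h : ∀ i : Fin k, (S.filter fun v => col v = i).card = m) : S.card = k * m := by
  rw [Finset.card_eq_sum_card_fiberwise (f := col) (t := Finset.univ) (fun _ _ => by simp),
    Finset.sum_congr rfl fun i _ => h i]
  simp

/-- Two vertices of different colors lie in a common part of some partition into two parts, each
containing one vertex of each color. -/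
theorem exists_bipartition_of_color_ne [Fintype V] [DecidableEq V]
    (hcol : ∀ i : Fin k, (Finset.univ.filter fun v => col v = i).card = 2) {a b : V}
    (hab : col a ≠ col b) :
    ∃ P : Finpartition (Finset.univ : Finset V), (P.parts.card = 2 ∧
      ∀ S ∈ P.parts, ∀ i : Fin k, (S.filter fun v => col v = i).card = 1) ∧
      ∃ S ∈ P.parts, a ∈ S ∧ b ∈ S := by
  have hf : ∃ f : Fin k → V, (∀ i, col (f i) = i) ∧ f (col a) = a ∧ f (col b) = b := by
    have hne : ∀ i, ∃ v, col v = i := fun i => by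
      have : 0 < (Finset.univ.filter fun v => col v = i).card := by rw [hcol]; norm_num
      obtain ⟨v, hv⟩ := Finset.card_pos.1 this
      exact ⟨v, (Finset.mem_filter.1 hv).2⟩
    choose g hg using hne
    refine ⟨Function.update (Function.update g (col a) a) (col b) b, fun i => ?_, ?_, ?_⟩
    · by_cases hb : i = col b
      · subst hb; simp
      · by_cases ha : i = col a
        · subst ha; simp [hab]
        · simp [ha, hb, hg]
    · simp [hab]
    · simp
  obtain ⟨f, hf, hfa, hfb⟩ := hf
  set S : Finset V := Finset.univ.image f with hSdef
  have haS : a ∈ S := Finset.mem_image.2 ⟨col a, Finset.mem_univ _, hfa⟩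
  have hbS : b ∈ S := Finset.mem_image.2 ⟨col b, Finset.mem_univ _, hfb⟩
  have hS : ∀ i : Fin k, (S.filter fun v => col v = i).card = 1 := fun i => by
    refine Finset.card_eq_one.2 ⟨f i, ?_⟩
    ext v
    simp only [hSdef, mem_filter, mem_image, mem_univ, true_and, mem_singleton]
    constructor
    · rintro ⟨⟨j, rfl⟩, rfl⟩
      rw [hf]
    · rintro rfl
      exact ⟨⟨i, rfl⟩, hf i⟩
  have hSc : ∀ i : Fin k, (Sᶜ.filter fun v => col v = i).card = 1 := fun i => by
    have h1 := Finset.card_union_of_disjoint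
      (Finset.disjoint_filter_filter (p := fun v => col v = i) (q := fun v => col v = i)
        (disjoint_compl_right (a := S)))
    rw [← Finset.filter_union, Finset.union_compl, hcol, hS] at h1
    omega
  have hne : ∀ T : Finset V, (∀ i : Fin k, (T.filter fun v => col v = i).card = 1) → T ≠ ∅ := by
    rintro _ hT rfl
    simpa using hT (col a)
  have hSSc : S ≠ Sᶜ := fun h => Finset.mem_compl.1 (h ▸ haS) haS
  refine ⟨{ parts := {S, Sᶜ}
            supIndep := ?_
            sup_parts := by simp
            bot_notMem := ?_ }, ⟨Finset.card_pair hSSc, ?_⟩, S, by simp, haS, hbS⟩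
  · rw [Finset.supIndep_pair hSSc]
    exact disjoint_compl_right
  · simp only [Finset.bot_eq_empty, Finset.mem_insert, Finset.mem_singleton, not_or]
    exact ⟨(hne S hS).symm, (hne Sᶜ hSc).symm⟩
  · intro T hT
    rcases Finset.mem_insert.1 hT with rfl | hT
    · exact hS
    · rw [Finset.mem_singleton.1 hT]
      exact hSc

end Coloring

section TwoPerColor

variable {k : ℕ} {col : Fin (2 * k) → Fin k}

theorem fairSet_of_card_color_eq_one
    (hcol : ∀ i : Fin k, (Finset.univ.filter fun v => col v = i).card = 2)
    {S : Finset (Fin (2 * k))} (hS : ∀ i : Fin k, (S.filter fun v => col v = i).card = 1) :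
    FairSet col S := by
  intro i
  rw [hS, hcol, card_eq_mul_of_card_color_eq hS, Fintype.card_fin]
  ring

theorem card_mul_eq_of_fairSet
    (hcol : ∀ i : Fin k, (Finset.univ.filter fun v => col v = i).card = 2)
    {S : Finset (Fin (2 * k))} (hS : FairSet col S) (i : Fin k) :
    (S.filter fun v => col v = i).card * k = S.card := by
  have h := hS i
  rw [hcol, Fintype.card_fin] at h
  linarith

/-- A fair partition is either trivial or consists of two parts with one vertex of each color. -/
theorem parts_eq_or_of_fairSet (hk : 0 < k)
    (hcol : ∀ i : Fin k, (Finset.univ.filter fun v => col v = i).card = 2)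
    (P : Finpartition (Finset.univ : Finset (Fin (2 * k))))
    (hP : ∀ S ∈ P.parts, FairSet col S) :
    Finset.univ ∈ P.parts ∨ (P.parts.card = 2 ∧
      ∀ S ∈ P.parts, ∀ i : Fin k, (S.filter fun v => col v = i).card = 1) := by
  refine or_iff_not_imp_left.2 fun huniv => ?_
  have hone : ∀ S ∈ P.parts, ∀ i : Fin k, (S.filter fun v => col v = i).card = 1 := by
    intro S hS i
    have hi := card_mul_eq_of_fairSet hcol (hP S hS) i
    have hle : (S.filter fun v => col v = i).card ≤ 2 :=
      (Finset.card_le_card (Finset.filter_subset_filter _ (Finset.subset_univ S))).trans_eq (hcol i)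
    have hpos : 0 < S.card := Finset.card_pos.2 (P.nonempty_of_mem_parts hS)
    have hlt : S.card ≠ 2 * k := fun h => huniv <| by
      have hS_univ : S = Finset.univ := (Finset.card_eq_iff_eq_univ S).1 (by simp [h])
      subst hS_univ
      exact hS
    interval_cases h : (S.filter fun v => col v = i).card <;> omega
  refine ⟨?_, hone⟩
  have hsum := P.sum_card_parts
  rw [Finset.sum_congr rfl fun S hS => card_eq_mul_of_card_color_eq (hone S hS)] at hsum
  simp only [mul_one, Finset.sum_const, smul_eq_mul, Finset.card_univ, Fintype.card_fin] at hsum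
  exact Nat.eq_of_mul_eq_mul_right hk hsum

theorem ccCost_add_ncard_edgeSet_of_bipartition (G : SimpleGraph (Fin (2 * k)))
    {P : Finpartition (Finset.univ : Finset (Fin (2 * k)))}
    (hP : P.parts.card = 2 ∧
      ∀ S ∈ P.parts, ∀ i : Fin k, (S.filter fun v => col v = i).card = 1) :
    ccCost G P.parts + G.edgeSet.ncard = 2 * k.choose 2 + 2 * interCost G P.parts := by
  rw [ccCost_add_ncard_edgeSet,
    Finset.sum_congr rfl fun S hS => by rw [card_eq_mul_of_card_color_eq (hP.2 S hS), mul_one],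
    Finset.sum_const, hP.1, smul_eq_mul]

/-- Some partition of the path into two parts with one vertex of each color is cheaper than the
trivial partition. -/
theorem exists_bipartition_ccCost_lt (hk : 3 ≤ k)
    (hcol : ∀ i : Fin k, (Finset.univ.filter fun v => col v = i).card = 2) :
    ∃ P : Finpartition (Finset.univ : Finset (Fin (2 * k))), (P.parts.card = 2 ∧
      ∀ S ∈ P.parts, ∀ i : Fin k, (S.filter fun v => col v = i).card = 1) ∧
      ∀ Q : Finpartition (Finset.univ : Finset (Fin (2 * k))), Finset.univ ∈ Q.parts →
        ccCost (SimpleGraph.pathGraph (2 * k)) P.parts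
          < ccCost (SimpleGraph.pathGraph (2 * k)) Q.parts := by
  have hab : ∃ a b, (SimpleGraph.pathGraph (2 * k)).Adj a b ∧ col a ≠ col b := by
    by_contra! h
    have h01 := h ⟨0, by omega⟩ ⟨1, by omega⟩ (SimpleGraph.pathGraph_adj.2 (Or.inl rfl))
    have h12 := h ⟨1, by omega⟩ ⟨2, by omega⟩ (SimpleGraph.pathGraph_adj.2 (Or.inl rfl))
    have hsub : ({⟨0, by omega⟩, ⟨1, by omega⟩, ⟨2, by omega⟩} : Finset (Fin (2 * k)))
        ⊆ Finset.univ.filter fun v => col v = col ⟨1, by omega⟩ := by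
      simp [Finset.insert_subset_iff, h01, h12]
    have hle := Finset.card_le_card hsub
    rw [hcol, Finset.card_eq_three.2 ⟨_, _, _, by simp, by simp, by simp, rfl⟩] at hle
    omega
  obtain ⟨a, b, hadj, hne⟩ := hab
  obtain ⟨P, hP, S, hS, ha, hb⟩ := exists_bipartition_of_color_ne hcol hne
  refine ⟨P, hP, fun Q hQ => ?_⟩
  have h1 := interCost_lt_ncard_edgeSet hS hadj ha hb
  have h2 := ncard_edgeSet_pathGraph_lt (2 * k) (by omega)
  have h3 := ccCost_add_ncard_edgeSet_of_bipartition (SimpleGraph.pathGraph (2 * k)) hP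
  have h4 := ccCost_add_ncard_edgeSet (SimpleGraph.pathGraph (2 * k)) Q
  have h5 := Finset.single_le_sum (f := fun S : Finset (Fin (2 * k)) => S.card.choose 2)
    (fun _ _ => Nat.zero_le _) hQ
  simp only [Finset.card_univ, Fintype.card_fin] at h5
  have h6 : 2 * k.choose 2 + k * k = (2 * k).choose 2 := by
    rw [two_mul k, Nat.add_choose_eq]
    simp [Finset.Nat.antidiagonal_succ]
    ring
  nlinarith [sq_nonneg ((k : ℤ) - 2)]

end TwoPerColor

/-- On a path with `2k` vertices (`k ≥ 3`) colored with `k` colors,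
each appearing exactly twice: (a) every minimum-cost fair partition has exactly two
parts, each containing exactly one vertex of each color; (b) such a two-part partition
is of minimum correlation clustering cost among all fair partitions iff it minimizes
the number of cut edges among all such two-part partitions. -/
theorem stmt10 (k : ℕ) (hk : 3 ≤ k) (col : Fin (2 * k) → Fin k)
    (hcol : ∀ i : Fin k, (Finset.univ.filter fun v => col v = i).card = 2) :
    (∀ P : Finpartition (Finset.univ : Finset (Fin (2 * k))),
      (∀ S ∈ P.parts, FairSet col S) →
      (∀ Q : Finpartition (Finset.univ : Finset (Fin (2 * k))),
        (∀ S ∈ Q.parts, FairSet col S) →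
        ccCost (SimpleGraph.pathGraph (2 * k)) P.parts
          ≤ ccCost (SimpleGraph.pathGraph (2 * k)) Q.parts) →
      (P.parts.card = 2 ∧
        ∀ S ∈ P.parts, ∀ i : Fin k, (S.filter fun v => col v = i).card = 1))
    ∧
    (∀ P : Finpartition (Finset.univ : Finset (Fin (2 * k))),
      (P.parts.card = 2 ∧
        ∀ S ∈ P.parts, ∀ i : Fin k, (S.filter fun v => col v = i).card = 1) →
      ((∀ Q : Finpartition (Finset.univ : Finset (Fin (2 * k))),
          (∀ S ∈ Q.parts, FairSet col S) →
          ccCost (SimpleGraph.pathGraph (2 * k)) P.parts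
            ≤ ccCost (SimpleGraph.pathGraph (2 * k)) Q.parts)
        ↔
        (∀ Q : Finpartition (Finset.univ : Finset (Fin (2 * k))),
          (Q.parts.card = 2 ∧
            ∀ S ∈ Q.parts, ∀ i : Fin k, (S.filter fun v => col v = i).card = 1) →
          interCost (SimpleGraph.pathGraph (2 * k)) P.parts
            ≤ interCost (SimpleGraph.pathGraph (2 * k)) Q.parts))) := by
  obtain ⟨P₀, hP₀, hlt⟩ := exists_bipartition_ccCost_lt hk hcol
  have hk0 : 0 < k := by omega
  have hfair : ∀ P : Finpartition (Finset.univ : Finset (Fin (2 * k))), (P.parts.card = 2 ∧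
      ∀ S ∈ P.parts, ∀ i : Fin k, (S.filter fun v => col v = i).card = 1) →
      ∀ S ∈ P.parts, FairSet col S :=
    fun P hP S hS => fairSet_of_card_color_eq_one hcol (hP.2 S hS)
  have hcost := fun P hP => ccCost_add_ncard_edgeSet_of_bipartition (col := col)
    (SimpleGraph.pathGraph (2 * k)) (P := P) hP
  refine ⟨fun P hP hmin => ?_, fun P hP => ⟨fun hmin Q hQ => ?_, fun hmin Q hQ => ?_⟩⟩
  · refine (parts_eq_or_of_fairSet hk0 hcol P hP).resolve_left fun h => ?_
    exact (hlt P h).not_ge (hmin P₀ (hfair P₀ hP₀))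
  · have := hmin Q (hfair Q hQ)
    have := hcost P hP
    have := hcost Q hQ
    omega
  · have hle : ∀ R : Finpartition (Finset.univ : Finset (Fin (2 * k))), (R.parts.card = 2 ∧
        ∀ S ∈ R.parts, ∀ i : Fin k, (S.filter fun v => col v = i).card = 1) →
        ccCost (SimpleGraph.pathGraph (2 * k)) P.parts
          ≤ ccCost (SimpleGraph.pathGraph (2 * k)) R.parts := fun R hR => by
      have := hmin R hR
      have := hcost P hP
      have := hcost R hR
      omega
    rcases parts_eq_or_of_fairSet hk0 hcol Q hQ with h | h
    · exact (hle P₀ hP₀).trans (hlt Q h).le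
    · exact hle Q h
end

section
/- Let G be a graph with n vertices and m edges and let 𝒫 be a partition of its vertex set with inter-cluster cost χ. Then the intra-cluster cost ψ of 𝒫 satisfies ψ ≥ n²/(2|𝒫|) − n/2 − m + χ. Moreover, if every part of 𝒫 has size exactly n/|𝒫|, then ψ = n²/(2|𝒫|) − n/2 − m + χ. -/
open Finset

/-- Every edge is either cut by a partition or lies inside a block, so `ψ + m` counts the pairs
of distinct vertices lying in a common block, plus `χ`. -/
theorem intraCost_add_ncard_edgeSet {V : Type*} [Finite V] (G : SimpleGraph V)
    (P : Finset (Finset V)) :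
    intraCost G P + G.edgeSet.ncard =
      {e : Sym2 V | ¬ e.IsDiag ∧ ∀ u ∈ e, ∀ v ∈ e, SameBlock P u v}.ncard + interCost G P := by
  set W := {e : Sym2 V | ¬ e.IsDiag ∧ ∀ u ∈ e, ∀ v ∈ e, SameBlock P u v}
  have hintra : {e : Sym2 V | ¬ e.IsDiag ∧ e ∉ G.edgeSet ∧ ∀ u ∈ e, ∀ v ∈ e, SameBlock P u v} =
      W \ G.edgeSet := by
    ext e
    simp only [W, Set.mem_ofPred_eq, Set.mem_sdiff]
    tauto
  have hinter : {e : Sym2 V | e ∈ G.edgeSet ∧ ∃ u ∈ e, ∃ v ∈ e, ¬ SameBlock P u v} =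
      G.edgeSet \ W := by
    ext e
    simp only [W, Set.mem_ofPred_eq, Set.mem_sdiff]
    refine and_congr_right fun he => ?_
    simp [G.not_isDiag_of_mem_edgeSet he]
  have hW := Set.ncard_inter_add_ncard_sdiff_eq_ncard W G.edgeSet (Set.toFinite _)
  have hE := Set.ncard_inter_add_ncard_sdiff_eq_ncard G.edgeSet W (Set.toFinite _)
  rw [Set.inter_comm] at hE
  rw [intraCost, interCost, hintra, hinter]
  omega

/-- The intra-cluster cost in terms of the sizes of the blocks. -/
theorem intraCost_eq {V : Type*} [Fintype V] [DecidableEq V]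
    (G : SimpleGraph V) (P : Finpartition (Finset.univ : Finset V)) :
    (intraCost G P.parts : ℚ) = (∑ S ∈ P.parts, (S.card : ℚ) ^ 2) / 2
      - (Fintype.card V : ℚ) / 2 - (G.edgeSet.ncard : ℚ) + (interCost G P.parts : ℚ) := by
  have h := intraCost_add_ncard_edgeSet G P.parts
  rw [ncard_sameBlock_pairs] at h
  have hq : (intraCost G P.parts : ℚ) + G.edgeSet.ncard =
      ∑ S ∈ P.parts, (S.card.choose 2 : ℚ) + interCost G P.parts := by exact_mod_cast h
  have hn : (∑ S ∈ P.parts, (S.card : ℚ)) = Fintype.card V := by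
    exact_mod_cast P.sum_card_parts
  have hc : ∑ S ∈ P.parts, (S.card.choose 2 : ℚ) =
      (∑ S ∈ P.parts, (S.card : ℚ) ^ 2) / 2 - (∑ S ∈ P.parts, (S.card : ℚ)) / 2 := by
    rw [sum_div, sum_div, ← sum_sub_distrib]
    refine sum_congr rfl fun S _ => ?_
    rw [Nat.cast_choose_two]
    ring
  linarith

/-- For every partition `P` of the vertices of a graph with `n`
vertices and `m` edges and inter-cluster cost `χ`, the intra-cluster cost `ψ` satisfies
`ψ ≥ n²/(2|P|) - n/2 - m + χ`, with equality if every part has size exactly `n/|P|`. -/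
theorem stmt13 {V : Type*} [Fintype V] [DecidableEq V]
    (G : SimpleGraph V) (P : Finpartition (Finset.univ : Finset V)) :
    ((Fintype.card V : ℚ) ^ 2 / (2 * (P.parts.card : ℚ)) - (Fintype.card V : ℚ) / 2
        - (G.edgeSet.ncard : ℚ) + (interCost G P.parts : ℚ)
      ≤ (intraCost G P.parts : ℚ))
    ∧ ((∀ S ∈ P.parts, S.card * P.parts.card = Fintype.card V) →
      (intraCost G P.parts : ℚ)
        = (Fintype.card V : ℚ) ^ 2 / (2 * (P.parts.card : ℚ)) - (Fintype.card V : ℚ) / 2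
          - (G.edgeSet.ncard : ℚ) + (interCost G P.parts : ℚ)) := by
  have hn : (∑ S ∈ P.parts, (S.card : ℚ)) = Fintype.card V := by
    exact_mod_cast P.sum_card_parts
  have hhalf : (Fintype.card V : ℚ) ^ 2 / (2 * (P.parts.card : ℚ)) =
      (Fintype.card V : ℚ) ^ 2 / P.parts.card / 2 := by
    rw [mul_comm, div_div]
  rw [intraCost_eq, hhalf, ← hn]
  rcases P.parts.eq_empty_or_nonempty with h0 | h0
  · simp [h0]
  have hk : (0 : ℚ) < P.parts.card := by exact_mod_cast h0.card_pos
  constructor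
  · gcongr
    rw [div_le_iff₀' hk]
    exact sq_sum_le_card_mul_sum_sq
  · intro h
    have hS : ∀ S ∈ P.parts, (S.card : ℚ) = Fintype.card V / P.parts.card := fun S hS => by
      rw [eq_div_iff hk.ne']
      exact_mod_cast h S hS
    rw [hn, sum_congr rfl fun S hS' => by rw [hS S hS'], sum_const, nsmul_eq_mul]
    field_simp
end

section
/- Let G be a graph with n vertices and m edges and let 𝒫 be a partition of its vertex set with |𝒫| ≥ 2 parts and inter-cluster cost χ, and suppose some part S ∈ 𝒫 satisfies |S| = n/|𝒫| + a for some a ≥ 0. Then the intra-cluster cost ψ of 𝒫 satisfies ψ ≥ a²·|𝒫|/(2|𝒫| − 2) + n²/(2|𝒫|) − n/2 − m + χ. -/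
open Finset

/-- The pairs of distinct vertices lying in a common block number at least
`∑ B, (|B| choose 2)`; each is a non-adjacent pair counted by `intraCost` or an edge
not counted by `interCost`. -/
theorem sum_choose_two_add_interCost_le {V : Type*} [Fintype V] [DecidableEq V]
    (G : SimpleGraph V) (P : Finpartition (Finset.univ : Finset V)) :
    ∑ B ∈ P.parts, B.card.choose 2 + interCost G P.parts
      ≤ intraCost G P.parts + G.edgeSet.ncard := by
  set pairs : Finset (Sym2 V) := P.parts.biUnion fun B => B.offDiag.image Sym2.mk.uncurry
    with hpairs
  have hpairs_card : pairs.card = ∑ B ∈ P.parts, B.card.choose 2 := by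
    rw [hpairs, Finset.card_biUnion]
    · exact Finset.sum_congr rfl fun B _ => Sym2.card_image_offDiag B
    · intro B hB C hC hne
      rw [Function.onFun, Finset.disjoint_left]
      rintro e he he'
      simp only [Finset.mem_image, Finset.mem_offDiag, Prod.exists] at he he'
      obtain ⟨u, v, ⟨hu, hv, -⟩, rfl⟩ := he
      obtain ⟨x, y, ⟨hx, hy, -⟩, hxy⟩ := he'
      have hdisj := Finset.disjoint_left.mp (P.disjoint hB hC hne) hu
      rcases Sym2.eq_iff.mp hxy with ⟨rfl, rfl⟩ | ⟨rfl, rfl⟩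
      · exact hdisj hx
      · exact hdisj hy
  set intra : Set (Sym2 V) :=
    {e | ¬ e.IsDiag ∧ e ∉ G.edgeSet ∧ ∀ u ∈ e, ∀ v ∈ e, SameBlock P.parts u v} with hintra
  set inter : Set (Sym2 V) :=
    {e | e ∈ G.edgeSet ∧ ∃ u ∈ e, ∃ v ∈ e, ¬ SameBlock P.parts u v} with hinter
  have hsub : (pairs : Set (Sym2 V)) ⊆ intra ∪ (G.edgeSet \ inter) := by
    intro e he
    simp only [hpairs, Finset.coe_biUnion, Set.mem_iUnion, Finset.mem_coe, Finset.mem_image,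
      Finset.mem_offDiag, Prod.exists] at he
    obtain ⟨B, hB, u, v, ⟨hu, hv, huv⟩, rfl⟩ := he
    have hmem : ∀ x ∈ s(u, v), x ∈ B := by
      intro x hx
      rcases Sym2.mem_iff.mp hx with rfl | rfl <;> assumption
    have hsame : ∀ x ∈ s(u, v), ∀ y ∈ s(u, v), SameBlock P.parts x y :=
      fun x hx y hy => ⟨B, hB, hmem x hx, hmem y hy⟩
    by_cases hadj : s(u, v) ∈ G.edgeSet
    · refine Or.inr ⟨hadj, ?_⟩
      rintro ⟨-, x, hx, y, hy, hxy⟩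
      exact hxy (hsame x hx y hy)
    · exact Or.inl ⟨fun hd => huv (Sym2.mk_isDiag_iff.mp hd), hadj, hsame⟩
  have hle := Set.ncard_le_ncard hsub (Set.toFinite _)
  rw [Set.ncard_coe_finset, hpairs_card] at hle
  have hunion := Set.ncard_union_le intra (G.edgeSet \ inter)
  have hdiff : (G.edgeSet \ inter).ncard + inter.ncard = G.edgeSet.ncard :=
    Set.ncard_sdiff_add_ncard_of_subset (fun e he => he.1) (Set.toFinite _)
  change _ + inter.ncard ≤ intra.ncard + _
  omega

/-- Separating one element `i` of `s`, Cauchy-Schwarz for the others bounds `∑ f ^ 2` below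
in terms of the deviation `a` of `f i` from the mean. -/
theorem sq_sum_div_card_add_le_sum_sq {ι : Type*} [DecidableEq ι] (s : Finset ι) (f : ι → ℚ)
    (hs : 2 ≤ s.card) {i : ι} (hi : i ∈ s) {a : ℚ}
    (ha : f i = (∑ j ∈ s, f j) / (s.card : ℚ) + a) :
    (∑ j ∈ s, f j) ^ 2 / (s.card : ℚ) + a ^ 2 * (s.card : ℚ) / ((s.card : ℚ) - 1)
      ≤ ∑ j ∈ s, f j ^ 2 := by
  have hcs := sq_sum_le_card_mul_sum_sq (s := s.erase i) (f := f)
  have hcard : ((s.erase i).card : ℚ) = (s.card : ℚ) - 1 := by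
    rw [← Finset.card_erase_add_one hi]
    push_cast
    ring
  have hsum := Finset.add_sum_erase s f hi
  rw [← Finset.add_sum_erase s (fun j => f j ^ 2) hi]
  rw [hcard] at hcs
  have hk : (2 : ℚ) ≤ s.card := by exact_mod_cast hs
  generalize (s.card : ℚ) = k at *
  generalize ∑ j ∈ s, f j = t at *
  have hk0 : k ≠ 0 := by linarith
  have hk1 : 0 < k - 1 := by linarith
  have hrest : ∑ j ∈ s.erase i, f j = t - f i := by linarith
  rw [hrest] at hcs
  have hdiv := (div_le_iff₀' hk1).mpr hcs
  have hid : t ^ 2 / k + a ^ 2 * k / (k - 1) = f i ^ 2 + (t - f i) ^ 2 / (k - 1) := by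
    rw [ha]
    have := hk1.ne'
    field_simp
    ring
  linarith

/-- If a partition `P` with at least two parts has a part of size
`n/|P| + a` with `a ≥ 0`, then its intra-cluster cost `ψ` satisfies
`ψ ≥ a²·|P|/(2|P| - 2) + n²/(2|P|) - n/2 - m + χ`. -/
theorem stmt14 {V : Type*} [Fintype V] [DecidableEq V]
    (G : SimpleGraph V) (P : Finpartition (Finset.univ : Finset V))
    (hP : 2 ≤ P.parts.card)
    (S : Finset V) (hS : S ∈ P.parts) (a : ℚ) (ha : 0 ≤ a)
    (hcard : (S.card : ℚ) = (Fintype.card V : ℚ) / (P.parts.card : ℚ) + a) :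
    a ^ 2 * (P.parts.card : ℚ) / (2 * (P.parts.card : ℚ) - 2)
        + (Fintype.card V : ℚ) ^ 2 / (2 * (P.parts.card : ℚ)) - (Fintype.card V : ℚ) / 2
        - (G.edgeSet.ncard : ℚ) + (interCost G P.parts : ℚ)
      ≤ (intraCost G P.parts : ℚ) := by
  have hn : ∑ B ∈ P.parts, (B.card : ℚ) = Fintype.card V := by
    exact_mod_cast P.sum_card_parts
  have hsq := sq_sum_div_card_add_le_sum_sq P.parts (fun B => (B.card : ℚ)) hP hS
    (by rw [hn]; exact hcard)
  have hcount : (∑ B ∈ P.parts, (B.card.choose 2 : ℚ)) + interCost G P.parts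
      ≤ intraCost G P.parts + G.edgeSet.ncard := by
    exact_mod_cast sum_choose_two_add_interCost_le G P
  have hchoose : ∑ B ∈ P.parts, (B.card.choose 2 : ℚ)
      = (∑ B ∈ P.parts, (B.card : ℚ) ^ 2) / 2 - (Fintype.card V : ℚ) / 2 := by
    rw [← hn, Finset.sum_div, Finset.sum_div, ← Finset.sum_sub_distrib]
    refine Finset.sum_congr rfl fun B _ => ?_
    rw [Nat.cast_choose_two]
    ring
  rw [hn] at hsq
  have hk : (2 : ℚ) ≤ P.parts.card := by exact_mod_cast hP
  have hhalf : a ^ 2 * (P.parts.card : ℚ) / (2 * (P.parts.card : ℚ) - 2)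
      + (Fintype.card V : ℚ) ^ 2 / (2 * (P.parts.card : ℚ))
      = ((Fintype.card V : ℚ) ^ 2 / (P.parts.card : ℚ)
        + a ^ 2 * (P.parts.card : ℚ) / ((P.parts.card : ℚ) - 1)) / 2 := by
    have h1 : 2 * (P.parts.card : ℚ) - 2 = ((P.parts.card : ℚ) - 1) * 2 := by ring
    rw [h1, mul_comm 2 (P.parts.card : ℚ), ← div_div, ← div_div]
    ring
  linarith
end

section
/- Let F be a forest with n vertices and m edges whose vertices are colored with k ≥ 2 colors in ratio c_1:c_2:…:c_k, where the c_i are positive integers with gcd(c_1,…,c_k)=1 and d = c_1+…+c_k ≥ 4. Then (a) every fair partition of the vertices of F all of whose parts have size d has correlation clustering cost at most (d−1)n/2 + m; (b) every fair partition of the vertices of F has correlation clustering cost at least (d−5)n/2 + 2n/d + m. Consequently, if (d²−5d+4)n + 2dm > 0, then every fair partition 𝒫 with all parts of size d satisfies cost(F,𝒫) ≤ α · cost(F,𝒬) for every fair partition 𝒬, where α = ((d²−d)n + 2dm) / ((d²−5d+4)n + 2dm). -/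
open Finset

theorem SimpleGraph.IsAcyclic.card_edgeFinset_lt_s18 {W : Type*} [Fintype W] [Nonempty W]
    {H : SimpleGraph W} [Fintype H.edgeSet] (hH : H.IsAcyclic) :
    #H.edgeFinset < Fintype.card W := by
  classical
  obtain ⟨T, hle, -, hT⟩ :=
    SimpleGraph.connected_top.exists_isTree_le_of_le_of_isAcyclic (le_top (a := H)) hH
  have hcard := hT.card_edgeFinset
  have hmono : #H.edgeFinset ≤ #T.edgeFinset := card_le_card (by simpa using hle)
  omega

theorem SimpleGraph.IsAcyclic.card_edgeFinset_inter_sym2_lt {V : Type*} [Fintype V]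
    [DecidableEq V] {F : SimpleGraph V} [DecidableRel F.Adj] (hF : F.IsAcyclic)
    {S : Finset V} (hS : S.Nonempty) :
    #(F.edgeFinset ∩ S.sym2) < #S := by
  have : Nonempty (S : Set V) := hS.to_subtype
  have h := (hF.induce (S : Set V)).card_edgeFinset_lt_s18
  have hmap := congrArg card (SimpleGraph.map_edgeFinset_induce (G := F) (s := (S : Set V)))
  rw [card_map, toFinset_coe] at hmap
  rw [← hmap]
  convert! h using 1
  · congr!
  · simp

theorem card_filter_not_isDiag_sym2 {V : Type*} [DecidableEq V] (S : Finset V) :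
    #{e ∈ S.sym2 | ¬ e.IsDiag} = (#S).choose 2 := by
  rw [← Sym2.card_image_offDiag, ← Sym2.filter_image_mk_not_isDiag]
  congr 2
  ext e
  induction e with
  | _ a b => aesop

theorem sameBlock_pairs_iff {V : Type*} [Fintype V] [DecidableEq V]
    (P : Finpartition (univ : Finset V)) (e : Sym2 V) :
    (∀ u ∈ e, ∀ v ∈ e, SameBlock P.parts u v) ↔ ∃ S ∈ P.parts, e ∈ S.sym2 := by
  induction e with
  | _ a b =>
    simp only [mk_mem_sym2_iff]
    refine ⟨fun h => h a (by simp) b (by simp), ?_⟩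
    rintro ⟨S, hS, ha, hb⟩ u hu v hv
    refine ⟨S, hS, ?_, ?_⟩
    · rcases Sym2.mem_iff.1 hu with rfl | rfl <;> assumption
    · rcases Sym2.mem_iff.1 hv with rfl | rfl <;> assumption

theorem pairwiseDisjoint_sym2_parts {V : Type*} [Fintype V] [DecidableEq V]
    (P : Finpartition (univ : Finset V)) :
    (P.parts : Set (Finset V)).PairwiseDisjoint Finset.sym2 := by
  intro S hS T hT hne
  refine disjoint_left.2 fun e heS heT => ?_
  induction e with
  | _ a b =>
    exact disjoint_left.1 (P.disjoint hS hT hne) (mk_mem_sym2_iff.1 heS).1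
      (mk_mem_sym2_iff.1 heT).1

/-- The cost of a partition, in terms of the number of edges inside each part. -/
theorem ccCost_add_two_mul {V : Type*} [Fintype V] [DecidableEq V]
    (F : SimpleGraph V) [DecidableRel F.Adj] (P : Finpartition (univ : Finset V)) :
    ccCost F P.parts + 2 * ∑ S ∈ P.parts, #(F.edgeFinset ∩ S.sym2)
      = ∑ S ∈ P.parts, (#S).choose 2 + F.edgeSet.ncard := by
  set A := P.parts.biUnion fun S => {e ∈ S.sym2 | ¬ e.IsDiag} with hA
  set B := P.parts.biUnion fun S => F.edgeFinset ∩ S.sym2 with hB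
  have hcardA : #A = ∑ S ∈ P.parts, (#S).choose 2 := by
    rw [hA, card_biUnion fun S hS T hT hne =>
      (pairwiseDisjoint_sym2_parts P hS hT hne).mono (filter_subset _ _) (filter_subset _ _)]
    exact sum_congr rfl fun S _ => card_filter_not_isDiag_sym2 S
  have hcardB : #B = ∑ S ∈ P.parts, #(F.edgeFinset ∩ S.sym2) :=
    card_biUnion fun S hS T hT hne =>
      (pairwiseDisjoint_sym2_parts P hS hT hne).mono inter_subset_right inter_subset_right
  have hBA : B ⊆ A := by
    intro e he
    simp only [hA, hB, mem_biUnion, mem_inter, mem_filter] at he ⊢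
    obtain ⟨S, hS, hedge, heS⟩ := he
    exact ⟨S, hS, heS, F.not_isDiag_of_mem_edgeFinset hedge⟩
  have hBE : B ⊆ F.edgeFinset := biUnion_subset.2 fun S _ => inter_subset_left
  have hintra : intraCost F P.parts = #(A \ B) := by
    rw [intraCost, ← Set.ncard_coe_finset]
    congr 1
    ext e
    simp only [sameBlock_pairs_iff, Set.mem_ofPred_eq, hA, hB, coe_sdiff, Set.mem_sdiff, mem_coe,
      mem_biUnion, mem_inter, mem_filter, SimpleGraph.mem_edgeFinset]
    grind
  have hinter : interCost F P.parts = #(F.edgeFinset \ B) := by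
    rw [interCost, ← Set.ncard_coe_finset]
    congr 1
    ext e
    have := sameBlock_pairs_iff P e
    simp only [Set.mem_ofPred_eq, hB, coe_sdiff, Set.mem_sdiff, mem_coe,
      mem_biUnion, mem_inter, SimpleGraph.mem_edgeFinset]
    grind
  have hE : F.edgeSet.ncard = #F.edgeFinset := by
    rw [← Set.ncard_coe_finset, SimpleGraph.coe_edgeFinset]
  have h₁ := card_sdiff_add_card_eq_card hBA
  have h₂ := card_sdiff_add_card_eq_card hBE
  rw [ccCost, hintra, hinter, hE, ← hcardA, ← hcardB]
  omega

/-- The size of a fair set is a multiple of the sum of the coprime color ratios. -/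
theorem FairSet.sum_dvd_card {V : Type*} [Fintype V] {k : ℕ} {col : V → Fin k} {cs : Fin k → ℕ}
    (hgcd : univ.gcd cs = 1)
    (hratio : ∀ i : Fin k,
      (univ.filter fun v => col v = i).card * (∑ j, cs j) = cs i * Fintype.card V)
    {S : Finset V} (hS : FairSet col S) :
    ∑ j, cs j ∣ #S := by
  rcases S.eq_empty_or_nonempty with rfl | ⟨v, -⟩
  · simp
  have hn : 0 < Fintype.card V := Fintype.card_pos_iff.2 ⟨v⟩
  have hdvd : ∀ i, ∑ j, cs j ∣ cs i * #S := fun i => by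
    refine ⟨#(S.filter fun v => col v = i), Nat.eq_of_mul_eq_mul_right hn ?_⟩
    calc cs i * #S * Fintype.card V = cs i * Fintype.card V * #S := by ring
      _ = (∑ j, cs j) * (#(univ.filter fun v => col v = i) * #S) := by rw [← hratio i]; ring
      _ = _ := by rw [← hS i]; ring
  have h := dvd_gcd (s := univ) fun i _ => hdvd i
  rwa [Finset.gcd_mul_right, hgcd, normalize_eq, one_mul] at h

theorem ccCost_le_of_card_eq {V : Type*} [Fintype V] [DecidableEq V]
    (F : SimpleGraph V) {d : ℕ} (P : Finpartition (univ : Finset V))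
    (hP : ∀ S ∈ P.parts, #S = d) :
    (ccCost F P.parts : ℚ)
      ≤ ((d : ℚ) - 1) * (Fintype.card V : ℚ) / 2 + (F.edgeSet.ncard : ℚ) := by
  classical
  have hcost : (ccCost F P.parts : ℚ) ≤ ∑ S ∈ P.parts, ((#S).choose 2 : ℚ) + F.edgeSet.ncard := by
    exact_mod_cast (Nat.le_add_right _ _).trans_eq (ccCost_add_two_mul F P)
  have hn : ∑ S ∈ P.parts, (#S : ℚ) = Fintype.card V := by
    exact_mod_cast P.sum_card_parts
  refine hcost.trans_eq ?_
  rw [← hn, mul_div_right_comm, mul_sum]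
  congr 1
  refine sum_congr rfl fun S hS => ?_
  rw [Nat.cast_choose_two, hP S hS]
  ring

theorem le_ccCost_of_le_card {V : Type*} [Fintype V] [DecidableEq V]
    {F : SimpleGraph V} (hF : F.IsAcyclic) {d : ℕ} (hd : 4 ≤ d)
    (Q : Finpartition (univ : Finset V)) (hQ : ∀ S ∈ Q.parts, d ≤ #S) :
    ((d : ℚ) - 5) * (Fintype.card V : ℚ) / 2
        + 2 * (Fintype.card V : ℚ) / (d : ℚ) + (F.edgeSet.ncard : ℚ)
      ≤ (ccCost F Q.parts : ℚ) := by
  classical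
  have hcost : (ccCost F Q.parts : ℚ) + 2 * ∑ S ∈ Q.parts, (#(F.edgeFinset ∩ S.sym2) : ℚ)
      = ∑ S ∈ Q.parts, ((#S).choose 2 : ℚ) + F.edgeSet.ncard := by
    exact_mod_cast ccCost_add_two_mul F Q
  have hn : ∑ S ∈ Q.parts, (#S : ℚ) = Fintype.card V := by
    exact_mod_cast Q.sum_card_parts
  have hd' : (4 : ℚ) ≤ d := by exact_mod_cast hd
  have hpart : ∀ S ∈ Q.parts, (((d : ℚ) - 5) / 2 + 2 / d) * #S
      ≤ ((#S).choose 2 : ℚ) - 2 * #(F.edgeFinset ∩ S.sym2) := fun S hS => by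
    have hedges : (#(F.edgeFinset ∩ S.sym2) : ℚ) + 1 ≤ #S := by
      exact_mod_cast hF.card_edgeFinset_inter_sym2_lt (Q.nonempty_of_mem_parts hS)
    have hds : (d : ℚ) ≤ #S := by exact_mod_cast hQ S hS
    have hprod : 0 ≤ ((#S : ℚ) - d) * (#S * d - 4) :=
      mul_nonneg (by linarith) (by nlinarith)
    have hgap : (#S : ℚ) * (#S - 1) / 2 - 2 * (#S - 1) - (((d : ℚ) - 5) / 2 + 2 / d) * #S
        = ((#S : ℚ) - d) * (#S * d - 4) / (2 * d) := by
      field_simp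
      ring
    have : 0 ≤ ((#S : ℚ) - d) * (#S * d - 4) / (2 * d) := div_nonneg hprod (by linarith)
    rw [Nat.cast_choose_two]
    linarith
  have hsum := sum_le_sum hpart
  rw [← mul_sum, sum_sub_distrib, ← mul_sum, hn] at hsum
  have : ((d : ℚ) - 5) * (Fintype.card V : ℚ) / 2 + 2 * (Fintype.card V : ℚ) / (d : ℚ)
      = (((d : ℚ) - 5) / 2 + 2 / d) * Fintype.card V := by ring
  linarith

/-- For a forest with `n` vertices, `m` edges and `k ≥ 2` colors in
ratio `c₁ : … : c_k` (coprime positive integers with sum `d ≥ 4`):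
(a) every fair partition with all parts of size `d` has cost at most `(d-1)n/2 + m`;
(b) every fair partition has cost at least `(d-5)n/2 + 2n/d + m`;
(c) consequently, if `(d²-5d+4)n + 2dm > 0`, every fair partition with all parts of
size `d` is an `α`-approximation with `α = ((d²-d)n + 2dm) / ((d²-5d+4)n + 2dm)`. -/
theorem stmt18 {V : Type*} [Fintype V] [DecidableEq V]
    (F : SimpleGraph V) (hF : F.IsAcyclic)
    (k : ℕ) (hk : 2 ≤ k) (col : V → Fin k) (cs : Fin k → ℕ)
    (hpos : ∀ i, 0 < cs i) (hgcd : Finset.univ.gcd cs = 1)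
    (hratio : ∀ i : Fin k,
      (Finset.univ.filter fun v => col v = i).card * (∑ j, cs j)
        = cs i * Fintype.card V)
    (d : ℕ) (hdsum : d = ∑ j, cs j) (hd4 : 4 ≤ d) :
    (∀ P : Finpartition (Finset.univ : Finset V),
      (∀ S ∈ P.parts, FairSet col S) → (∀ S ∈ P.parts, S.card = d) →
      (ccCost F P.parts : ℚ)
        ≤ ((d : ℚ) - 1) * (Fintype.card V : ℚ) / 2 + (F.edgeSet.ncard : ℚ))
    ∧
    (∀ Q : Finpartition (Finset.univ : Finset V),
      (∀ S ∈ Q.parts, FairSet col S) →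
      ((d : ℚ) - 5) * (Fintype.card V : ℚ) / 2
          + 2 * (Fintype.card V : ℚ) / (d : ℚ) + (F.edgeSet.ncard : ℚ)
        ≤ (ccCost F Q.parts : ℚ))
    ∧
    (0 < ((d : ℚ) ^ 2 - 5 * d + 4) * (Fintype.card V : ℚ)
          + 2 * (d : ℚ) * (F.edgeSet.ncard : ℚ) →
      ∀ P : Finpartition (Finset.univ : Finset V),
        (∀ S ∈ P.parts, FairSet col S) → (∀ S ∈ P.parts, S.card = d) →
        ∀ Q : Finpartition (Finset.univ : Finset V),
          (∀ S ∈ Q.parts, FairSet col S) →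
          (ccCost F P.parts : ℚ)
            ≤ (((d : ℚ) ^ 2 - d) * (Fintype.card V : ℚ)
                  + 2 * (d : ℚ) * (F.edgeSet.ncard : ℚ))
                / (((d : ℚ) ^ 2 - 5 * d + 4) * (Fintype.card V : ℚ)
                  + 2 * (d : ℚ) * (F.edgeSet.ncard : ℚ))
              * (ccCost F Q.parts : ℚ)) := by
  have hupper := fun (P : Finpartition (univ : Finset V)) (_ : ∀ S ∈ P.parts, FairSet col S) =>
    ccCost_le_of_card_eq F (d := d) P
  have hlower := fun (Q : Finpartition (univ : Finset V)) (hQ : ∀ S ∈ Q.parts, FairSet col S) =>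
    le_ccCost_of_le_card hF hd4 Q fun S hS =>
      Nat.le_of_dvd (card_pos.2 (Q.nonempty_of_mem_parts hS))
        (hdsum ▸ (hQ S hS).sum_dvd_card hgcd hratio)
  refine ⟨hupper, hlower, fun hden P hP hcard Q hQ => ?_⟩
  have hd : (4 : ℚ) ≤ d := by exact_mod_cast hd4
  have hup := hupper P hP hcard
  have hlow := hlower Q hQ
  rw [div_mul_eq_mul_div, le_div_iff₀ hden]
  set n : ℚ := (Fintype.card V : ℚ)
  set m : ℚ := (F.edgeSet.ncard : ℚ)
  have hn0 : 0 ≤ n := by positivity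
  have hm0 : 0 ≤ m := by positivity
  have hup' : ((d : ℚ) ^ 2 - d) * n + 2 * d * m = 2 * d * ((d - 1) * n / 2 + m) := by ring
  have hlow' : ((d : ℚ) ^ 2 - 5 * d + 4) * n + 2 * d * m
      = 2 * d * ((d - 5) * n / 2 + 2 * n / d + m) := by
    field_simp
    ring
  have hup0 : 0 ≤ ((d : ℚ) ^ 2 - d) * n + 2 * d * m :=
    add_nonneg (mul_nonneg (by nlinarith) hn0) (by positivity)
  calc (ccCost F P.parts : ℚ) * (((d : ℚ) ^ 2 - 5 * d + 4) * n + 2 * d * m)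
      ≤ ((d - 1) * n / 2 + m) * (((d : ℚ) ^ 2 - 5 * d + 4) * n + 2 * d * m) :=
        mul_le_mul_of_nonneg_right hup hden.le
    _ = (((d : ℚ) ^ 2 - d) * n + 2 * d * m) * ((d - 5) * n / 2 + 2 * n / d + m) := by
        rw [hlow', hup']
        ring
    _ ≤ _ := mul_le_mul_of_nonneg_left hlow hup0
end
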